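/- Suppose w₁ < 0 and m > 0, and set a₁ := √(−4m/(3w₁)) and κ₁ := √m. Then there exist ε₀ > 0 and C > 0 such that for every ε with 0 < |ε| < ε₀ there is a function u = u^ε, twice continuously differentiable on the closed strip Ω̄ = ℝ × [−π/2, π/2], bounded together with all its partial derivatives up to order two, satisfying ∇·((1 + 2w₁|∇u|²)∇u) + u − mε²u = 0 in Ω and u(x, ±π/2) = 0 for all x ∈ ℝ, and such that: (i) sup_{(x,y)∈Ω̄} |u(x,y) − a₁ε·sech(κ₁εx)·cos y| ≤ Cε²; (ii) u(x,y) → 0 uniformly in y as |x| → ∞. In particular sup |u^ε| ≥ a₁|ε| − Cε² > 0 for small ε, so u^ε is a nontrivial homoclinic (pulse-type) solution. -/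

import Mathlib

open Real Set Filter

/-- Partial derivative in the first (axial) variable. -/
noncomputable def pdx (u : ℝ × ℝ → ℝ) (p : ℝ × ℝ) : ℝ :=
  deriv (fun t => u (t, p.2)) p.1

/-- Partial derivative in the second (transversal) variable. -/
noncomputable def pdy (u : ℝ × ℝ → ℝ) (p : ℝ × ℝ) : ℝ :=
  deriv (fun t => u (p.1, t)) p.2


def CF : Type := ZeroAtInftyContinuousMap ℝ ℝ

noncomputable instance CF_ring : NonUnitalNormedCommRing CF :=
  inferInstanceAs (NonUnitalNormedCommRing (ZeroAtInftyContinuousMap ℝ ℝ))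
noncomputable instance CF_space : NormedSpace ℝ CF :=
  inferInstanceAs (NormedSpace ℝ (ZeroAtInftyContinuousMap ℝ ℝ))
instance CF_complete : CompleteSpace CF :=
  inferInstanceAs (CompleteSpace (ZeroAtInftyContinuousMap ℝ ℝ))
instance CF_tower : IsScalarTower ℝ CF CF :=
  inferInstanceAs (IsScalarTower ℝ (ZeroAtInftyContinuousMap ℝ ℝ) (ZeroAtInftyContinuousMap ℝ ℝ))
instance CF_comm : SMulCommClass ℝ CF CF :=
  inferInstanceAs (SMulCommClass ℝ (ZeroAtInftyContinuousMap ℝ ℝ) (ZeroAtInftyContinuousMap ℝ ℝ))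
instance CF_fun : FunLike CF ℝ ℝ :=
  inferInstanceAs (FunLike (ZeroAtInftyContinuousMap ℝ ℝ) ℝ ℝ)

def CF.mk' (f : ℝ → ℝ) (h1 : Continuous f) (h2 : Tendsto f (cocompact ℝ) (nhds 0)) : CF :=
  (⟨⟨f, h1⟩, h2⟩ : ZeroAtInftyContinuousMap ℝ ℝ)

theorem CF.mk'_apply (f : ℝ → ℝ) (h1 : Continuous f) (h2 : Tendsto f (cocompact ℝ) (nhds 0))
    (x : ℝ) : CF.mk' f h1 h2 x = f x := rfl
theorem CF.ext' {f g : CF} (h : ∀ x, f x = g x) : f = g := DFunLike.ext f g h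
theorem CF.add_apply (f g : CF) (x : ℝ) : (f + g) x = f x + g x := rfl
theorem CF.sub_apply (f g : CF) (x : ℝ) : (f - g) x = f x - g x := rfl
theorem CF.neg_apply (f : CF) (x : ℝ) : (-f) x = - f x := rfl
theorem CF.mul_apply (f g : CF) (x : ℝ) : (f * g) x = f x * g x := rfl
theorem CF.smul_apply (c : ℝ) (g : CF) (x : ℝ) : (c • g) x = c * g x := rfl
theorem CF.zero_apply (x : ℝ) : (0 : CF) x = 0 := rfl
theorem CF.cont (f : CF) : Continuous f :=
  (f : ZeroAtInftyContinuousMap ℝ ℝ).continuous_toFun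
theorem CF.tends (f : CF) : Tendsto f (cocompact ℝ) (nhds 0) :=
  ZeroAtInftyContinuousMap.zero_at_infty' f

noncomputable abbrev ES := lp (fun _ : ℤ => CF) 1

theorem ES_hasSum_norm (a : ES) : HasSum (fun k => ‖a k‖) ‖a‖ := by
  have h := lp.hasSum_norm (p := 1) (by simp) a
  simpa using h

theorem ES_coord_le (a : ES) (k : ℤ) : ‖a k‖ ≤ ‖a‖ :=
  le_hasSum (ES_hasSum_norm a) k (fun _ _ => norm_nonneg _)

noncomputable def sg (k : ℤ) : CF →L[ℝ] ES := lp.singleContinuousLinearMap ℝ (fun _ : ℤ => CF) 1 k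

theorem sg_same (k : ℤ) (f : CF) : (sg k f) k = f := by
  simp [sg]

theorem sg_ne {k j : ℤ} (h : j ≠ k) (f : CF) : (sg k f) j = 0 := by
  simp [sg, h]

theorem sg_norm (k : ℤ) (f : CF) : ‖sg k f‖ = ‖f‖ := by
  simp [sg, lp.norm_single]

theorem sg_norm_le (k : ℤ) : ‖sg k‖ ≤ 1 :=
  ContinuousLinearMap.opNorm_le_bound _ zero_le_one (fun f => by rw [sg_norm]; simp)

theorem hasSum_sg (a : ES) : HasSum (fun k => sg k (a k)) a :=
  lp.hasSum_single (by simp) a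

theorem ES_ext {G : Type*} [NormedAddCommGroup G] [NormedSpace ℝ G] {S T : ES →L[ℝ] G}
    (h : ∀ k f, S (sg k f) = T (sg k f)) : S = T := by
  ext a
  have h1 := S.hasSum (hasSum_sg a)
  have h2 := T.hasSum (hasSum_sg a)
  simp only [h] at h1
  exact h1.unique h2

section lift
variable {G : Type*} [NormedAddCommGroup G] [NormedSpace ℝ G] 

theorem lift_summable (T : ℤ → CF →L[ℝ] G) (C : ℝ) (hC : ∀ k, ‖T k‖ ≤ C) (a : ES) :
    Summable (fun k => ‖T k (a k)‖) :=
  Summable.of_nonneg_of_le (fun _ => norm_nonneg _)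
    (fun k => ((T k).le_opNorm _).trans (mul_le_mul_of_nonneg_right (hC k) (norm_nonneg _)))
    ((ES_hasSum_norm a).summable.mul_left C)

variable [CompleteSpace G]

noncomputable def lift (T : ℤ → CF →L[ℝ] G) (C : ℝ) (hC : ∀ k, ‖T k‖ ≤ C) : ES →L[ℝ] G :=
  LinearMap.mkContinuous
    { toFun := fun a => ∑' k, T k (a k)
      map_add' := fun a b => by
        rw [← ((lift_summable T C hC a).of_norm).tsum_add ((lift_summable T C hC b).of_norm)]
        simp
      map_smul' := fun c a => by
        simp only [RingHom.id_apply]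
        rw [← ((lift_summable T C hC a).of_norm).tsum_const_smul]
        simp }
    C (fun a => by
      simp only [LinearMap.coe_mk, AddHom.coe_mk]
      refine (norm_tsum_le_tsum_norm (lift_summable T C hC a)).trans ?_
      rw [← (ES_hasSum_norm a).tsum_eq, ← tsum_mul_left]
      exact (lift_summable T C hC a).tsum_le_tsum
        (fun k => ((T k).le_opNorm _).trans (mul_le_mul_of_nonneg_right (hC k) (norm_nonneg _)))
        ((ES_hasSum_norm a).summable.mul_left C))

theorem lift_apply (T : ℤ → CF →L[ℝ] G) (C : ℝ) (hC : ∀ k, ‖T k‖ ≤ C) (a : ES) :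
    lift T C hC a = ∑' k, T k (a k) := rfl

theorem lift_hasSum (T : ℤ → CF →L[ℝ] G) (C : ℝ) (hC : ∀ k, ‖T k‖ ≤ C) (a : ES) :
    HasSum (fun k => T k (a k)) (lift T C hC a) :=
  (lift_summable T C hC a).of_norm.hasSum

theorem lift_sg (T : ℤ → CF →L[ℝ] G) (C : ℝ) (hC : ∀ k, ‖T k‖ ≤ C) (k : ℤ) (f : CF) :
    lift T C hC (sg k f) = T k f := by
  rw [lift_apply, tsum_eq_single k]
  · rw [sg_same]
  · intro j hj
    rw [sg_ne hj, map_zero]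

theorem lift_norm (T : ℤ → CF →L[ℝ] G) (C : ℝ) (hC : ∀ k, ‖T k‖ ≤ C) : ‖lift T C hC‖ ≤ C :=
  LinearMap.mkContinuous_norm_le _ ((norm_nonneg _).trans (hC 0)) _
end lift

/-- coordinate projection -/
noncomputable def pj (k : ℤ) : ES →L[ℝ] CF :=
  LinearMap.mkContinuous
    { toFun := fun a => a k
      map_add' := fun a b => by simp
      map_smul' := fun c a => by simp } 1 (fun a => by
      rw [one_mul]; exact ES_coord_le a k)

theorem pj_apply (k : ℤ) (a : ES) : pj k a = a k := rfl

theorem diag_bound {T : ℤ → CF →L[ℝ] CF} {C : ℝ} (hC : ∀ k, ‖T k‖ ≤ C) (k : ℤ) :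
    ‖(sg k).comp (T k)‖ ≤ C := by
  refine (ContinuousLinearMap.opNorm_comp_le _ _).trans ?_
  have := mul_le_mul (sg_norm_le k) (hC k) (norm_nonneg _) zero_le_one
  simpa using this

noncomputable def diag (T : ℤ → CF →L[ℝ] CF) (C : ℝ) (hC : ∀ k, ‖T k‖ ≤ C) : ES →L[ℝ] ES :=
  lift (fun k => (sg k).comp (T k)) C (diag_bound hC)

theorem diag_norm (T : ℤ → CF →L[ℝ] CF) (C : ℝ) (hC : ∀ k, ‖T k‖ ≤ C) : ‖diag T C hC‖ ≤ C :=
  lift_norm _ _ _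

theorem diag_sg (T : ℤ → CF →L[ℝ] CF) (C : ℝ) (hC : ∀ k, ‖T k‖ ≤ C) (k : ℤ) (f : CF) :
    diag T C hC (sg k f) = sg k (T k f) := by
  rw [diag, lift_sg]; rfl

theorem diag_apply (T : ℤ → CF →L[ℝ] CF) (C : ℝ) (hC : ∀ k, ‖T k‖ ≤ C) (a : ES) (k : ℤ) :
    (diag T C hC a) k = T k (a k) := by
  have : (pj k).comp (diag T C hC) = (T k).comp (pj k) := by
    apply ES_ext
    intro j f
    simp only [ContinuousLinearMap.comp_apply, diag_sg, pj_apply]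
    by_cases h : k = j
    · subst h; simp [sg_same]
    · rw [sg_ne h, sg_ne h, map_zero]
  exact congrArg (fun S : ES →L[ℝ] CF => S a) this

/-- convolution -/
theorem cv_bound1 (k j : ℤ) :
    ‖(ContinuousLinearMap.compL ℝ CF CF ES (sg (k + j))).comp (ContinuousLinearMap.mul ℝ CF)‖ ≤ 1 := by
  refine ContinuousLinearMap.opNorm_le_bound _ zero_le_one (fun f => ?_)
  refine ContinuousLinearMap.opNorm_le_bound _ (by positivity) (fun g => ?_)
  simp only [ContinuousLinearMap.comp_apply, ContinuousLinearMap.compL_apply,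
    ContinuousLinearMap.mul_apply', sg_norm, one_mul]
  exact norm_mul_le f g

noncomputable def cvk (k : ℤ) : CF →L[ℝ] ES →L[ℝ] ES :=
  (lift (fun j => (ContinuousLinearMap.compL ℝ CF CF ES (sg (k + j))).comp
    (ContinuousLinearMap.mul ℝ CF)) 1 (cv_bound1 k)).flip

theorem cvk_bound (k : ℤ) : ‖cvk k‖ ≤ 1 := by
  rw [cvk, ContinuousLinearMap.opNorm_flip]
  exact lift_norm _ _ _

noncomputable def cv : ES →L[ℝ] ES →L[ℝ] ES := lift cvk 1 cvk_bound

theorem cv_sg (k j : ℤ) (f g : CF) : cv (sg k f) (sg j g) = sg (k + j) (f * g) := by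
  rw [cv, lift_sg, cvk, ContinuousLinearMap.flip_apply, lift_sg]
  simp [mul_comm]

theorem bil_ext {G : Type*} [NormedAddCommGroup G] [NormedSpace ℝ G] {S T : ES →L[ℝ] ES →L[ℝ] G}
    (h : ∀ k f j g, S (sg k f) (sg j g) = T (sg k f) (sg j g)) : S = T := by
  apply ES_ext
  intro k f
  apply ES_ext
  intro j g
  exact h k f j g

/-- multiplicative maps -/
theorem mult_of_sg (σ : ES →L[ℝ] ES)
    (h : ∀ k f j g, σ (sg (k + j) (f * g)) = cv (σ (sg k f)) (σ (sg j g))) (a b : ES) :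
    σ (cv a b) = cv (σ a) (σ b) := by
  have : (ContinuousLinearMap.compL ℝ ES ES ES σ).comp cv = (cv.bilinearComp σ σ) := by
    apply bil_ext
    intro k f j g
    simp [cv_sg, h]
  exact congrArg (fun S : ES →L[ℝ] ES →L[ℝ] ES => S a b) this

/-- reflection in k -/
noncomputable def Jk : ES →L[ℝ] ES := lift (fun k => sg (-k)) 1 (fun _ => sg_norm_le _)

theorem Jk_sg (k : ℤ) (f : CF) : Jk (sg k f) = sg (-k) f := by rw [Jk, lift_sg]

theorem Jk_apply (a : ES) (k : ℤ) : (Jk a) k = a (-k) := by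
  have : (pj k).comp Jk = pj (-k) := by
    apply ES_ext
    intro j f
    simp only [ContinuousLinearMap.comp_apply, Jk_sg, pj_apply]
    by_cases h : k = -j
    · subst h; simp [sg_same]
    · rw [sg_ne h, sg_ne (by omega)]
  exact congrArg (fun S : ES →L[ℝ] CF => S a) this

theorem Jk_cv (a b : ES) : Jk (cv a b) = cv (Jk a) (Jk b) := by
  apply mult_of_sg
  intro k f j g
  rw [Jk_sg, Jk_sg, Jk_sg, cv_sg]
  congr 1
  ring_nf

/-- sign (-1)^k -/
noncomputable def sgnk (k : ℤ) : ℝ := if Even k then 1 else -1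

theorem sgnk_add (k j : ℤ) : sgnk (k + j) = sgnk k * sgnk j := by
  unfold sgnk
  simp only [Int.even_add]
  split_ifs <;> simp_all

theorem Pk_bound (k : ℤ) : ‖sgnk k • ContinuousLinearMap.id ℝ CF‖ ≤ 1 := by
  rw [norm_smul]
  have : ‖sgnk k‖ = 1 := by unfold sgnk; split_ifs <;> simp
  rw [this, one_mul]
  exact ContinuousLinearMap.norm_id_le

noncomputable def Pk : ES →L[ℝ] ES := diag (fun k => sgnk k • ContinuousLinearMap.id ℝ CF) 1 Pk_bound

theorem Pk_apply (a : ES) (k : ℤ) : (Pk a) k = sgnk k • a k := by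
  rw [Pk, diag_apply]; rfl

theorem Pk_sg (k : ℤ) (f : CF) : Pk (sg k f) = sgnk k • sg k f := by
  rw [Pk, diag_sg]; simp

theorem Pk_cv (a b : ES) : Pk (cv a b) = cv (Pk a) (Pk b) := by
  apply mult_of_sg
  intro k f j g
  rw [Pk_sg, Pk_sg, Pk_sg]
  simp [cv_sg, sgnk_add, smul_smul, mul_comm]

/-- C₀ facts -/
theorem CF_abs_le (f : CF) (x : ℝ) : |f x| ≤ ‖f‖ := by
  have := (ZeroAtInftyContinuousMap.toBCF f).norm_coe_le_norm x
  exact this.trans_eq (ZeroAtInftyContinuousMap.norm_toBCF_eq_norm (f := f))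

theorem CF_norm_le (f : CF) {C : ℝ} (hC : 0 ≤ C) (h : ∀ x, |f x| ≤ C) : ‖f‖ ≤ C := by
  refine (ZeroAtInftyContinuousMap.norm_toBCF_eq_norm (f := f)).symm.trans_le ?_
  exact (BoundedContinuousFunction.norm_le hC).2 h

noncomputable def refl0 (f : CF) : CF :=
  CF.mk' (fun x => f (-x)) (f.cont.comp continuous_neg)
    (f.tends.comp (Homeomorph.neg ℝ).isClosedEmbedding.tendsto_cocompact)

noncomputable def rfn : CF →L[ℝ] CF :=
  LinearMap.mkContinuous
    { toFun := refl0
      map_add' := fun f g => rfl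
      map_smul' := fun c f => rfl } 1
    (fun f => CF_norm_le _ (by positivity) (fun x => by
      rw [one_mul]; exact CF_abs_le f (-x)))

theorem rfn_apply (f : CF) (x : ℝ) : rfn f x = f (-x) := rfl

theorem rfn_norm : ‖rfn‖ ≤ 1 := LinearMap.mkContinuous_norm_le _ zero_le_one _

noncomputable def Rk : ES →L[ℝ] ES := diag (fun _ => rfn) 1 (fun _ => rfn_norm)

theorem Rk_apply (a : ES) (k : ℤ) : (Rk a) k = rfn (a k) := by rw [Rk, diag_apply]

theorem Rk_cv (a b : ES) : Rk (cv a b) = cv (Rk a) (Rk b) := by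
  apply mult_of_sg
  intro k f j g
  simp only [Rk, diag_sg, cv_sg]
  congr 1

/-- evaluation -/
noncomputable def evF (x : ℝ) : CF →L[ℝ] ℝ :=
  LinearMap.mkContinuous
    { toFun := fun f => f x
      map_add' := fun f g => rfl
      map_smul' := fun c f => rfl } 1 (fun f => by rw [one_mul]; exact CF_abs_le f x)

noncomputable def ek (k : ℤ) (y : ℝ) : ℂ := Complex.exp ((k * y : ℝ) * Complex.I)

theorem ek_norm (k : ℤ) (y : ℝ) : ‖ek k y‖ = 1 := Complex.norm_exp_ofReal_mul_I _

theorem ek_add (k j : ℤ) (y : ℝ) : ek (k + j) y = ek k y * ek j y := by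
  rw [ek, ek, ek, ← Complex.exp_add]; push_cast; ring_nf

noncomputable def evk (x y : ℝ) (k : ℤ) : CF →L[ℝ] ℂ := (evF x).smulRight (ek k y)

theorem evk_apply (x y : ℝ) (k : ℤ) (f : CF) : evk x y k f = (f x : ℂ) * ek k y := by
  rw [evk, ContinuousLinearMap.smulRight_apply, Complex.real_smul]; rfl

theorem evk_bound (x y : ℝ) (k : ℤ) : ‖evk x y k‖ ≤ 1 := by
  refine ContinuousLinearMap.opNorm_le_bound _ zero_le_one (fun f => ?_)
  rw [evk_apply, norm_mul, ek_norm]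
  simpa using CF_abs_le f x

noncomputable def ev (x y : ℝ) : ES →L[ℝ] ℂ := lift (evk x y) 1 (evk_bound x y)

theorem ev_hasSum (x y : ℝ) (a : ES) : HasSum (fun k => (a k x : ℂ) * ek k y) (ev x y a) := by
  have := lift_hasSum (evk x y) 1 (evk_bound x y) a
  simp only [evk_apply] at this
  exact this

theorem ev_norm_le (x y : ℝ) (a : ES) : ‖ev x y a‖ ≤ ‖a‖ := by
  have := (ev x y).le_of_opNorm_le (lift_norm _ _ _) a
  simpa using this

theorem ev_cv (x y : ℝ) (a b : ES) : ev x y (cv a b) = ev x y a * ev x y b := by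
  have : (ContinuousLinearMap.compL ℝ ES ES ℂ (ev x y)).comp cv =
      ((ContinuousLinearMap.mul ℝ ℂ).bilinearComp (ev x y) (ev x y)) := by
    apply bil_ext
    intro k f j g
    simp only [ContinuousLinearMap.comp_apply, ContinuousLinearMap.compL_apply, cv_sg,
      ContinuousLinearMap.bilinearComp_apply, ContinuousLinearMap.mul_apply']
    simp only [ev, lift_sg, evk_apply, ek_add]
    simp only [CF.mul_apply]
    push_cast
    ring
  exact congrArg (fun S : ES →L[ℝ] ES →L[ℝ] ℂ => S a b) this


theorem contraction_lemma {Λ E : Type*} [NormedAddCommGroup Λ] [NormedSpace ℝ Λ]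
    [NormedAddCommGroup E] [NormedSpace ℝ E] [CompleteSpace E] (Φ : Λ × E → E)
    (hΦ : ContDiff ℝ 1 Φ) (h0 : Φ 0 = 0)
    (hD : ∀ h : E, HasDerivAt (fun t : ℝ => Φ (0, t • h)) 0 0) :
    ∃ δ > 0, ∃ C > 0, ∀ l : Λ, ‖l‖ < δ → ∀ S : Set E, IsClosed S → (0 : E) ∈ S →
      (∀ h ∈ S, Φ (l, h) ∈ S) → ∃ h ∈ S, Φ (l, h) = h ∧ ‖h‖ ≤ C * ‖l‖ := by
  have hs : HasStrictFDerivAt Φ (fderiv ℝ Φ 0) 0 :=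
    hΦ.contDiffAt.hasStrictFDerivAt (by simp)
  set D := fderiv ℝ Φ 0 with hDdef
  have hDz : ∀ h : E, D (0, h) = 0 := by
    intro h
    have h1 : HasDerivAt (fun t : ℝ => ((0 : Λ), t • h)) ((0 : Λ), h) 0 := by
      refine HasDerivAt.prodMk (hasDerivAt_const _ _) ?_
      simpa using (hasDerivAt_id (0 : ℝ)).smul_const h
    have h2 : HasFDerivAt Φ D ((0 : Λ), (0 : ℝ) • h) := by
      rw [zero_smul]; exact hs.hasFDerivAt
    have h3 := h2.comp_hasDerivAt (0 : ℝ) h1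
    exact h3.unique (hD h)
  have hl := hs.isLittleO
  rw [Asymptotics.isLittleO_iff] at hl
  have hl2 := hl (show (0 : ℝ) < 1 / 2 by norm_num)
  rw [Metric.eventually_nhds_iff] at hl2
  obtain ⟨ρ, hρ, hball⟩ := hl2
  have key : ∀ x y : Λ × E, ‖x‖ < ρ → ‖y‖ < ρ → ‖Φ x - Φ y - D (x - y)‖ ≤ 1 / 2 * ‖x - y‖ := by
    intro x y hx hy
    refine hball (y := (x, y)) ?_
    rw [dist_eq_norm]
    simp only [Prod.norm_def, Prod.fst_sub, Prod.snd_sub, Prod.fst_zero, Prod.snd_zero, sub_zero]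
    simp only [Prod.norm_def] at hx hy
    exact max_lt hx hy
  have hlip : ∀ l : Λ, ‖l‖ < ρ → ∀ h h' : E, ‖h‖ < ρ → ‖h'‖ < ρ →
      ‖Φ (l, h) - Φ (l, h')‖ ≤ 1 / 2 * ‖h - h'‖ := by
    intro l hl h h' hh hh'
    have := key (l, h) (l, h') (by simp [Prod.norm_def, hl, hh]) (by simp [Prod.norm_def, hl, hh'])
    simpa [hDz, Prod.norm_def] using this
  have hzero : ∀ l : Λ, ‖l‖ < ρ → ‖Φ (l, 0)‖ ≤ (‖D‖ + 1 / 2) * ‖l‖ := by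
    intro l hl
    have h1 := key (l, 0) 0 (by simp [Prod.norm_def, hl, hρ]) (by simp [hρ])
    rw [h0, sub_zero, sub_zero] at h1
    have h2 : ‖((l, 0) : Λ × E)‖ = ‖l‖ := by simp [Prod.norm_def]
    rw [h2] at h1
    have h3 := D.le_opNorm (l, 0)
    rw [h2] at h3
    have h4 : ‖Φ (l, 0)‖ ≤ ‖Φ (l, 0) - D (l, 0)‖ + ‖D (l, 0)‖ := by
      simpa using norm_add_le (Φ (l, 0) - D (l, 0)) (D (l, 0))
    linarith
  set C := 2 * (‖D‖ + 1 / 2) with hC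
  have hCpos : 0 < C := by positivity
  refine ⟨min ρ (ρ / C), lt_min hρ (by positivity), C, hCpos, ?_⟩
  intro l hl S hS h0S hmap
  have hlρ : ‖l‖ < ρ := lt_of_lt_of_le hl (min_le_left _ _)
  have hr : C * ‖l‖ < ρ := by
    have := lt_of_lt_of_le hl (min_le_right _ _)
    rw [lt_div_iff₀ hCpos] at this
    linarith
  let B := S ∩ Metric.closedBall (0 : E) (C * ‖l‖)
  have hBc : IsComplete B := (hS.inter Metric.isClosed_closedBall).isComplete
  have hB0 : (0 : E) ∈ B := ⟨h0S, by simp; positivity⟩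
  have hBn : ∀ h ∈ B, ‖h‖ < ρ := fun h hh => by
    have := hh.2
    rw [mem_closedBall_zero_iff] at this
    linarith
  have hmaps : MapsTo (fun h => Φ (l, h)) B B := by
    intro h hh
    refine ⟨hmap h hh.1, ?_⟩
    have h1 := hlip l hlρ h 0 (hBn h hh) (by simpa using hρ)
    have h2 := hzero l hlρ
    have h3 := hh.2
    rw [mem_closedBall_zero_iff] at h3 ⊢
    have h4 : ‖Φ (l, h)‖ ≤ ‖Φ (l, h) - Φ (l, 0)‖ + ‖Φ (l, 0)‖ := by
      simpa using norm_add_le (Φ (l, h) - Φ (l, 0)) (Φ (l, 0))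
    rw [sub_zero] at h1
    have : (‖D‖ + 1 / 2) * ‖l‖ = 1 / 2 * (C * ‖l‖) := by rw [hC]; ring
    simp only
    linarith
  have hcon : ContractingWith (1 / 2) (hmaps.restrict (fun h => Φ (l, h)) B B) := by
    refine ⟨by rw [← NNReal.coe_lt_coe]; norm_num, LipschitzWith.of_dist_le_mul ?_⟩
    intro h h'
    rw [Subtype.dist_eq, Subtype.dist_eq, dist_eq_norm, dist_eq_norm]
    have := hlip l hlρ h h' (hBn h h.2) (hBn h' h'.2)
    simpa using this
  obtain ⟨h, hhB, hfix, -⟩ := hcon.exists_fixedPoint' hBc hmaps hB0 (edist_ne_top _ _)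
  refine ⟨h, hhB.1, hfix, ?_⟩
  simpa using hhB.2

noncomputable def tri (a b c : ES) : ES := cv (cv a b) c

noncomputable def NN (P Q R S T : ES) : ES :=
  (3 : ℝ) • tri P P R - tri Q Q R - (4 : ℝ) • tri P Q S + tri P P T - (3 : ℝ) • tri Q Q T

abbrev LOp := ES →L[ℝ] ES

abbrev LamT := ES × ES × ES × LOp × LOp × LOp × LOp × LOp × LOp

/-- the nonlinear map -/
noncomputable def PhiN (q0 t0 : ES) (Q0 T0 Pi : LOp) (z : LamT × ES) : ES :=
  ((8 / 3 : ℝ) • (Pi + z.1.2.2.2.2.2.2.2.2)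
    (NN (z.1.1 + z.1.2.2.2.1 z.2) (q0 + Q0 z.2 + z.1.2.2.2.2.1 z.2)
      (z.1.2.1 + z.1.2.2.2.2.2.1 z.2) (z.1.2.2.1 + z.1.2.2.2.2.2.2.1 z.2)
      (t0 + T0 z.2 + z.1.2.2.2.2.2.2.2.1 z.2)))
  + (8 : ℝ) • Pi (tri q0 q0 t0 + tri (Q0 z.2) q0 t0 + tri q0 (Q0 z.2) t0 + tri q0 q0 (T0 z.2))

theorem tri_contDiff {X : Type*} [NormedAddCommGroup X] [NormedSpace ℝ X] {a b c : X → ES}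
    (ha : ContDiff ℝ 1 a) (hb : ContDiff ℝ 1 b) (hc : ContDiff ℝ 1 c) :
    ContDiff ℝ 1 (fun x => tri (a x) (b x) (c x)) := by
  unfold tri
  exact (cv.contDiff.comp ((cv.contDiff.comp ha).clm_apply hb)).clm_apply hc

theorem PhiN_contDiff (q0 t0 : ES) (Q0 T0 Pi : LOp) : ContDiff ℝ 1 (PhiN q0 t0 Q0 T0 Pi) := by
  have c1 : ContDiff ℝ 1 (fun z : LamT × ES => z.1.1 + z.1.2.2.2.1 z.2) :=
    ContDiff.add (by fun_prop) (ContDiff.clm_apply (by fun_prop) (by fun_prop))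
  have c2 : ContDiff ℝ 1 (fun z : LamT × ES => q0 + Q0 z.2 + z.1.2.2.2.2.1 z.2) :=
    ContDiff.add (by fun_prop) (ContDiff.clm_apply (by fun_prop) (by fun_prop))
  have c3 : ContDiff ℝ 1 (fun z : LamT × ES => z.1.2.1 + z.1.2.2.2.2.2.1 z.2) :=
    ContDiff.add (by fun_prop) (ContDiff.clm_apply (by fun_prop) (by fun_prop))
  have c4 : ContDiff ℝ 1 (fun z : LamT × ES => z.1.2.2.1 + z.1.2.2.2.2.2.2.1 z.2) :=
    ContDiff.add (by fun_prop) (ContDiff.clm_apply (by fun_prop) (by fun_prop))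
  have c5 : ContDiff ℝ 1 (fun z : LamT × ES => t0 + T0 z.2 + z.1.2.2.2.2.2.2.2.1 z.2) :=
    ContDiff.add (by fun_prop) (ContDiff.clm_apply (by fun_prop) (by fun_prop))
  have cq : ContDiff ℝ 1 (fun z : LamT × ES => Q0 z.2) := by fun_prop
  have ct : ContDiff ℝ 1 (fun z : LamT × ES => T0 z.2) := by fun_prop
  have k0 : ContDiff ℝ 1 (fun _ : LamT × ES => q0) := contDiff_const
  have k1 : ContDiff ℝ 1 (fun _ : LamT × ES => t0) := contDiff_const
  unfold PhiN NN
  refine ContDiff.add (ContDiff.const_smul _ (ContDiff.clm_apply (by fun_prop) ?_))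
    (ContDiff.const_smul _ (Pi.contDiff.comp ?_))
  · exact (((((tri_contDiff c1 c1 c3).const_smul _).sub (tri_contDiff c2 c2 c3)).sub
      ((tri_contDiff c1 c2 c4).const_smul _)).add (tri_contDiff c1 c1 c5)).sub
      ((tri_contDiff c2 c2 c5).const_smul _)
  · exact (((tri_contDiff k0 k0 k1).add (tri_contDiff cq k0 k1)).add (tri_contDiff k0 cq k1)).add
      (tri_contDiff k0 k0 ct)

theorem PhiN_at0 (q0 t0 : ES) (Q0 T0 Pi : LOp) (h : ES) (s : ℝ) :
    PhiN q0 t0 Q0 T0 Pi (0, s • h) =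
     s ^ 2 • ((-8 : ℝ) • Pi (tri (Q0 h) (Q0 h) t0 + tri (Q0 h) q0 (T0 h) + tri q0 (Q0 h) (T0 h)))
     + s ^ 3 • ((-8 : ℝ) • Pi (tri (Q0 h) (Q0 h) (T0 h))) := by
  simp only [PhiN, NN, tri, Prod.fst_zero, Prod.snd_zero, add_zero, zero_add, map_zero, map_add,
    map_smul, map_sub, zero_apply, add_apply,
    smul_apply, smul_zero, sub_zero, zero_sub, smul_add, map_neg, smul_neg]
  module

theorem PhiN_zero (q0 t0 : ES) (Q0 T0 Pi : LOp) : PhiN q0 t0 Q0 T0 Pi 0 = 0 := by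
  have := PhiN_at0 q0 t0 Q0 T0 Pi 0 0
  rw [smul_zero] at this
  refine Eq.trans this ?_
  simp

theorem PhiN_deriv (q0 t0 : ES) (Q0 T0 Pi : LOp) (h : ES) :
    HasDerivAt (fun s : ℝ => PhiN q0 t0 Q0 T0 Pi (0, s • h)) 0 0 := by
  simp only [PhiN_at0]
  have h2 := (hasDerivAt_pow 2 (0 : ℝ)).smul_const ((-8 : ℝ) • Pi (tri (Q0 h) (Q0 h) t0 +
    tri (Q0 h) q0 (T0 h) + tri q0 (Q0 h) (T0 h)))
  have h3 := (hasDerivAt_pow 3 (0 : ℝ)).smul_const ((-8 : ℝ) • Pi (tri (Q0 h) (Q0 h) (T0 h)))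
  have := h2.add h3
  refine this.congr_deriv ?_
  simp

theorem PhiN_solve (q0 t0 : ES) (Q0 T0 Pi : LOp) :
    ∃ δ > 0, ∃ C > 0, ∀ l : LamT, ‖l‖ < δ → ∀ S : Set ES, IsClosed S → (0 : ES) ∈ S →
      (∀ h ∈ S, PhiN q0 t0 Q0 T0 Pi (l, h) ∈ S) →
      ∃ h ∈ S, PhiN q0 t0 Q0 T0 Pi (l, h) = h ∧ ‖h‖ ≤ C * ‖l‖ :=
  contraction_lemma _ (PhiN_contDiff q0 t0 Q0 T0 Pi) (PhiN_zero q0 t0 Q0 T0 Pi)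
    (PhiN_deriv q0 t0 Q0 T0 Pi)


structure GD where
  (p p1 ψ ψ1 q : ℝ → ℝ)
  (μ A A1 B B1 : ℝ)
  hp : ∀ X, HasDerivAt p (p1 X) X
  hp1 : ∀ X, HasDerivAt p1 (q X * p X) X
  hψ : ∀ X, HasDerivAt ψ (ψ1 X) X
  hψ1 : ∀ X, HasDerivAt ψ1 (q X * ψ X) X
  hW : ∀ X, p X * ψ1 X - p1 X * ψ X = 1
  h0 : ψ1 0 = 0
  hμ : 0 < μ
  hA : 0 ≤ A
  hA1 : 0 ≤ A1
  hB : 0 ≤ B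
  hB1 : 0 ≤ B1
  bp : ∀ X, 0 ≤ X → |p X| ≤ A * exp (-μ * X)
  bp1 : ∀ X, 0 ≤ X → |p1 X| ≤ A1 * exp (-μ * X)
  bψ : ∀ X, 0 ≤ X → |ψ X| ≤ B * exp (μ * X)
  bψ1 : ∀ X, 0 ≤ X → |ψ1 X| ≤ B1 * exp (μ * X)
  Cq : ℝ
  hCq : ∀ X, |q X| ≤ Cq
  hq : Continuous q
  qe : ∀ X, q (-X) = q X

theorem exp_tail {μ c X : ℝ} (hμ : 0 < μ) {g : ℝ → ℝ} (hg : Continuous g)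
    (h : ∀ s, X ≤ s → |g s| ≤ c * exp (-μ * s)) :
    MeasureTheory.IntegrableOn g (Ioi X) ∧ |∫ s in Ioi X, g s| ≤ c * exp (-μ * X) / μ := by
  have hi : MeasureTheory.IntegrableOn (fun s => c * exp (-μ * s)) (Ioi X) :=
    (exp_neg_integrableOn_Ioi X hμ).const_mul c
  have hae : ∀ᵐ s ∂(MeasureTheory.volume.restrict (Ioi X)), ‖g s‖ ≤ c * exp (-μ * s) := by
    refine (MeasureTheory.ae_restrict_iff' measurableSet_Ioi).2 (Eventually.of_forall ?_)
    intro s hs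
    exact h s (le_of_lt hs)
  refine ⟨MeasureTheory.Integrable.mono' hi hg.aestronglyMeasurable hae, ?_⟩
  have := MeasureTheory.norm_integral_le_of_norm_le hi hae
  rw [MeasureTheory.integral_const_mul, integral_exp_mul_Ioi (by linarith)] at this
  rw [Real.norm_eq_abs] at this
  refine this.trans_eq ?_
  field_simp

theorem exp_head {μ c X Y : ℝ} (hμ : 0 < μ) (hc : 0 ≤ c) (hXY : X ≤ Y) {g : ℝ → ℝ}
    (h : ∀ s, X ≤ s → s ≤ Y → |g s| ≤ c * exp (μ * s)) :
    |∫ s in X..Y, g s| ≤ c * exp (μ * Y) / μ := by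
  have h1 : ‖∫ s in X..Y, g s‖ ≤ ∫ s in X..Y, c * exp (μ * s) := by
    refine intervalIntegral.norm_integral_le_of_norm_le hXY (Eventually.of_forall ?_) ?_
    · intro s hs
      exact h s hs.1.le hs.2
    · exact Continuous.intervalIntegrable (by fun_prop) _ _
  rw [Real.norm_eq_abs] at h1
  refine h1.trans ?_
  rw [intervalIntegral.integral_const_mul, intervalIntegral.integral_comp_mul_left (fun s => exp s) hμ.ne',
    integral_exp, smul_eq_mul, mul_div_assoc]
  refine mul_le_mul_of_nonneg_left ?_ hc
  rw [inv_mul_eq_div]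
  gcongr
  have := exp_pos (μ * X)
  linarith

namespace GD
variable (d : GD)

noncomputable def a (f : CF) (X : ℝ) : ℝ := (∫ s in Ioi (0:ℝ), d.p s * f s) - ∫ s in (0:ℝ)..X, d.p s * f s
noncomputable def b (f : CF) (X : ℝ) : ℝ := ∫ s in (0:ℝ)..X, d.ψ s * f s
noncomputable def v (f : CF) (X : ℝ) : ℝ := - d.ψ X * d.a f X - d.p X * d.b f X
noncomputable def v1 (f : CF) (X : ℝ) : ℝ := - d.ψ1 X * d.a f X - d.p1 X * d.b f X

theorem cp : Continuous d.p := continuous_iff_continuousAt.2 fun X => (d.hp X).continuousAt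
theorem cψ : Continuous d.ψ := continuous_iff_continuousAt.2 fun X => (d.hψ X).continuousAt
theorem cpf (f : CF) : Continuous (fun s => d.p s * f s) := d.cp.mul f.cont
theorem cψf (f : CF) : Continuous (fun s => d.ψ s * f s) := d.cψ.mul f.cont

theorem a_tail (f : CF) {X M : ℝ} (hX : 0 ≤ X) (hM : ∀ s, X ≤ s → |f s| ≤ M) :
    MeasureTheory.IntegrableOn (fun s => d.p s * f s) (Ioi X) ∧
    |∫ s in Ioi X, d.p s * f s| ≤ (d.A * M) * exp (-d.μ * X) / d.μ := by
  refine exp_tail d.hμ (d.cpf f) ?_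
  intro s hs
  rw [abs_mul]
  have := mul_le_mul (d.bp s (hX.trans hs)) (hM s hs) (abs_nonneg _)
    (mul_nonneg d.hA (exp_pos _).le)
  linarith

theorem int_p (f : CF) : MeasureTheory.IntegrableOn (fun s => d.p s * f s) (Ioi 0) :=
  (d.a_tail f le_rfl (M := ‖f‖) (fun s _ => CF_abs_le f s)).1

theorem a_eq (f : CF) {X : ℝ} (hX : 0 ≤ X) : d.a f X = ∫ s in Ioi X, d.p s * f s := by
  rw [a, ← intervalIntegral.integral_Ioi_sub_Ioi (d.int_p f) hX]
  ring

theorem a_le (f : CF) {X M : ℝ} (hX : 0 ≤ X) (hM : ∀ s, X ≤ s → |f s| ≤ M) :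
    |d.a f X| ≤ (d.A * M) * exp (-d.μ * X) / d.μ := by
  rw [d.a_eq f hX]
  exact (d.a_tail f hX hM).2

theorem b_diff (f : CF) {X Y M : ℝ} (hX : 0 ≤ X) (hXY : X ≤ Y) (hM0 : 0 ≤ M)
    (hM : ∀ s, X ≤ s → |f s| ≤ M) :
    |d.b f Y - d.b f X| ≤ (d.B * M) * exp (d.μ * Y) / d.μ := by
  have : d.b f Y - d.b f X = ∫ s in X..Y, d.ψ s * f s := by
    rw [b, b, intervalIntegral.integral_interval_sub_left] <;>
      exact (d.cψf f).intervalIntegrable _ _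
  rw [this]
  refine exp_head d.hμ (mul_nonneg d.hB hM0) hXY ?_
  intro s hs _
  rw [abs_mul]
  have := mul_le_mul (d.bψ s (hX.trans hs)) (hM s hs) (abs_nonneg _)
    (mul_nonneg d.hB (exp_pos _).le)
  linarith

theorem b_le (f : CF) {X : ℝ} (hX : 0 ≤ X) :
    |d.b f X| ≤ (d.B * ‖f‖) * exp (d.μ * X) / d.μ := by
  have := d.b_diff f le_rfl hX (norm_nonneg f) (fun s _ => CF_abs_le f s)
  simpa [b] using this

theorem da (f : CF) (X : ℝ) : HasDerivAt (d.a f) (-(d.p X * f X)) X := by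
  have := ((d.cpf f).integral_hasStrictDerivAt 0 X).hasDerivAt
  exact this.const_sub _

theorem db (f : CF) (X : ℝ) : HasDerivAt (d.b f) (d.ψ X * f X) X :=
  ((d.cψf f).integral_hasStrictDerivAt 0 X).hasDerivAt

theorem dv (f : CF) (X : ℝ) : HasDerivAt (d.v f) (d.v1 f X) X := by
  have := ((d.hψ X).neg.mul (d.da f X)).sub ((d.hp X).mul (d.db f X))
  refine this.congr_deriv ?_
  simp only [v1, Pi.neg_apply]; ring

theorem dv1 (f : CF) (X : ℝ) : HasDerivAt (d.v1 f) (f X + d.q X * d.v f X) X := by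
  have := ((d.hψ1 X).neg.mul (d.da f X)).sub ((d.hp1 X).mul (d.db f X))
  refine this.congr_deriv ?_
  have hW := d.hW X
  simp only [v, Pi.neg_apply]
  linear_combination f X * hW

theorem v1_zero (f : CF) : d.v1 f 0 = 0 := by
  simp [v1, d.h0, b]

/-- generic bound of a combination. -/
theorem comb_le {r g : ℝ → ℝ} {R G : ℝ} (hR : 0 ≤ R) (hG : 0 ≤ G)
    (br : ∀ X, 0 ≤ X → |r X| ≤ R * exp (d.μ * X))
    (bg : ∀ X, 0 ≤ X → |g X| ≤ G * exp (-d.μ * X)) (f : CF) {X : ℝ} (hX : 0 ≤ X) :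
    |-r X * d.a f X - g X * d.b f X| ≤ (d.A * R + d.B * G) / d.μ * ‖f‖ := by
  have hμ := d.hμ
  have h1 := d.a_le f hX (M := ‖f‖) (fun s _ => CF_abs_le f s)
  have h2 := d.b_le f hX
  have e1 : exp (d.μ * X) * exp (-d.μ * X) = 1 := by
    rw [← exp_add]; simp
  have h3 : |r X * d.a f X| ≤ d.A * R / d.μ * ‖f‖ := by
    rw [abs_mul]
    refine (mul_le_mul (br X hX) h1 (abs_nonneg _) (by positivity)).trans_eq ?_
    linear_combination (d.A * R / d.μ * ‖f‖) * e1
  have h4 : |g X * d.b f X| ≤ d.B * G / d.μ * ‖f‖ := by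
    rw [abs_mul]
    refine (mul_le_mul (bg X hX) h2 (abs_nonneg _) (by positivity)).trans_eq ?_
    linear_combination (d.B * G / d.μ * ‖f‖) * e1
  have h5 := abs_sub (-r X * d.a f X) (g X * d.b f X)
  rw [neg_mul, abs_neg] at h5
  rw [neg_mul]
  refine h5.trans ((add_le_add h3 h4).trans_eq ?_)
  ring

theorem comb_tendsto {r g : ℝ → ℝ} {R G : ℝ} (hR : 0 ≤ R) (hG : 0 ≤ G)
    (br : ∀ X, 0 ≤ X → |r X| ≤ R * exp (d.μ * X))
    (bg : ∀ X, 0 ≤ X → |g X| ≤ G * exp (-d.μ * X)) (f : CF) :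
    Tendsto (fun X => -r X * d.a f X - g X * d.b f X) atTop (nhds 0) := by
  have hμ := d.hμ
  have hA := d.hA
  have hB := d.hB
  rw [Metric.tendsto_atTop]
  intro ε hε
  -- choose δ
  set K := (d.A * R + d.B * G) / d.μ with hK
  have hK0 : 0 ≤ K := by positivity
  obtain ⟨δ, hδ, hδK⟩ : ∃ δ > 0, K * δ < ε / 2 := by
    refine ⟨ε / (4 * (K + 1)), by positivity, ?_⟩
    rw [mul_div_assoc', div_lt_div_iff₀ (by positivity) (by norm_num)]
    nlinarith
  have hf : Tendsto f atTop (nhds 0) := f.tends.mono_left atTop_le_cocompact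
  rw [Metric.tendsto_atTop] at hf
  obtain ⟨X1, hX1⟩ := hf δ hδ
  set X0 := max X1 0 with hX0
  have hX00 : 0 ≤ X0 := le_max_right _ _
  have hfd : ∀ s, X0 ≤ s → |f s| ≤ δ := by
    intro s hs
    have := hX1 s ((le_max_left _ _).trans hs)
    rw [Real.dist_eq, sub_zero] at this
    exact this.le
  have hdec : Tendsto (fun X => G * |d.b f X0| * exp (-d.μ * X)) atTop (nhds 0) := by
    have : Tendsto (fun X => exp (-d.μ * X)) atTop (nhds 0) := by
      refine Real.tendsto_exp_atBot.comp ?_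
      exact tendsto_id.const_mul_atTop_of_neg (by linarith)
    simpa using this.const_mul (G * |d.b f X0|)
  rw [Metric.tendsto_atTop] at hdec
  obtain ⟨X2, hX2⟩ := hdec (ε / 2) (by positivity)
  refine ⟨max X0 X2, fun X hX => ?_⟩
  have hXX0 : X0 ≤ X := (le_max_left _ _).trans hX
  have hXp : 0 ≤ X := hX00.trans hXX0
  have h6 := hX2 X ((le_max_right _ _).trans hX)
  rw [Real.dist_eq, sub_zero] at h6 ⊢
  have h6' := (le_abs_self _).trans_lt h6
  have h1 := d.a_le f hXp (M := δ) (fun s hs => hfd s (hXX0.trans hs))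
  have h2 := d.b_diff f hX00 hXX0 hδ.le hfd
  have h2' : |d.b f X| ≤ |d.b f X0| + (d.B * δ) * exp (d.μ * X) / d.μ := by
    have := abs_add_le (d.b f X - d.b f X0) (d.b f X0)
    rw [sub_add_cancel] at this
    linarith
  have e1 : exp (d.μ * X) * exp (-d.μ * X) = 1 := by
    rw [← exp_add]; simp
  have h3 : |r X * d.a f X| ≤ d.A * R / d.μ * δ := by
    rw [abs_mul]
    refine (mul_le_mul (br X hXp) h1 (abs_nonneg _) (by positivity)).trans_eq ?_
    linear_combination (d.A * R / d.μ * δ) * e1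
  have h4 : |g X * d.b f X| ≤ d.B * G / d.μ * δ + G * |d.b f X0| * exp (-d.μ * X) := by
    rw [abs_mul]
    refine (mul_le_mul (bg X hXp) h2' (abs_nonneg _) (by positivity)).trans_eq ?_
    linear_combination (d.B * G / d.μ * δ) * e1
  have h5 := abs_sub (-r X * d.a f X) (g X * d.b f X)
  rw [neg_mul, abs_neg] at h5
  rw [neg_mul]
  have : K * δ = d.A * R / d.μ * δ + d.B * G / d.μ * δ := by rw [hK]; ring
  linarith

theorem a_add (f g : CF) (X : ℝ) : d.a (f + g) X = d.a f X + d.a g X := by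
  simp only [a, CF.add_apply, mul_add]
  rw [MeasureTheory.integral_add (d.int_p f) (d.int_p g), intervalIntegral.integral_add
    ((d.cpf f).intervalIntegrable _ _) ((d.cpf g).intervalIntegrable _ _)]
  ring

theorem b_add (f g : CF) (X : ℝ) : d.b (f + g) X = d.b f X + d.b g X := by
  simp only [b, CF.add_apply, mul_add]
  rw [intervalIntegral.integral_add
    ((d.cψf f).intervalIntegrable _ _) ((d.cψf g).intervalIntegrable _ _)]

theorem a_smul (c : ℝ) (f : CF) (X : ℝ) : d.a (c • f) X = c * d.a f X := by
  simp only [a, CF.smul_apply, mul_left_comm _ c]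
  rw [MeasureTheory.integral_const_mul, intervalIntegral.integral_const_mul]
  ring

theorem b_smul (c : ℝ) (f : CF) (X : ℝ) : d.b (c • f) X = c * d.b f X := by
  simp only [b, CF.smul_apply, mul_left_comm _ c]
  rw [intervalIntegral.integral_const_mul]

end GD

/-- even/odd gluing -/
theorem glue_deriv {f f1 g g1 : ℝ → ℝ} (hf : ∀ x, HasDerivAt f (f1 x) x)
    (hg : ∀ x, HasDerivAt g (g1 x) x) (h0 : f 0 = g 0) (h1 : f1 0 = g1 0) (x : ℝ) :
    HasDerivAt (fun x => if 0 ≤ x then f x else g x) (if 0 ≤ x then f1 x else g1 x) x := by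
  rcases lt_trichotomy x 0 with hx | hx | hx
  · rw [if_neg (not_le.2 hx)]
    refine (hg x).congr_of_eventuallyEq ?_
    filter_upwards [Iio_mem_nhds hx] with y hy
    rw [if_neg (not_le.2 hy)]
  · subst hx
    rw [if_pos le_rfl]
    have hr : HasDerivWithinAt (fun x => if 0 ≤ x then f x else g x) (f1 0) (Ici 0) 0 := by
      refine (hf 0).hasDerivWithinAt.congr (fun y hy => if_pos hy) (if_pos le_rfl)
    have hl : HasDerivWithinAt (fun x => if 0 ≤ x then f x else g x) (f1 0) (Iic 0) 0 := by
      rw [h1]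
      refine (hg 0).hasDerivWithinAt.congr (fun y hy => ?_) (by simp [h0])
      rcases (show y ≤ 0 from hy).lt_or_eq with h | h
      · rw [if_neg (not_le.2 h)]
      · subst h; simp [h0]
    have := hl.union hr
    rw [Iic_union_Ici] at this
    exact this.hasDerivAt univ_mem
  · rw [if_pos hx.le]
    refine (hf x).congr_of_eventuallyEq ?_
    filter_upwards [Ioi_mem_nhds hx] with y hy
    rw [if_pos (le_of_lt hy)]

theorem GD.exists_green (d : GD) : ∃ G G1 G2 : CF →L[ℝ] CF,
    ‖G‖ ≤ 2 * d.A * d.B / d.μ ∧ ‖G1‖ ≤ (d.A * d.B1 + d.B * d.A1) / d.μ ∧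
    ‖G2‖ ≤ 1 + d.Cq * (2 * d.A * d.B / d.μ) ∧
    (∀ f X, HasDerivAt (G f) (G1 f X) X) ∧ (∀ f X, HasDerivAt (G1 f) (G2 f X) X) ∧
    (∀ f X, G2 f X = f |X| + d.q X * G f X) ∧ (∀ f X, G f (-X) = G f X) ∧
    (∀ f X, G1 f (-X) = - G1 f X) := by
  have hμ := d.hμ
  have hA := d.hA
  have hB := d.hB
  have hA1 := d.hA1
  have hB1 := d.hB1
  -- the functions
  let g : CF → ℝ → ℝ := fun f x => if 0 ≤ x then d.v f x else d.v f (-x)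
  let g1 : CF → ℝ → ℝ := fun f x => if 0 ≤ x then d.v1 f x else - d.v1 f (-x)
  let g2 : CF → ℝ → ℝ := fun f x => f |x| + d.q x * g f x
  have gabs : ∀ f x, g f x = d.v f |x| := by
    intro f x
    simp only [g]
    split_ifs with h
    · rw [abs_of_nonneg h]
    · rw [abs_of_neg (not_le.1 h)]
  have g1abs : ∀ f x, |g1 f x| = |d.v1 f (|x|)| := by
    intro f x
    simp only [g1]
    split_ifs with h
    · rw [abs_of_nonneg h]
    · rw [abs_of_neg (not_le.1 h), abs_neg]
  have dg : ∀ f x, HasDerivAt (g f) (g1 f x) x := by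
    intro f x
    refine glue_deriv (d.dv f) (g1 := fun x => - d.v1 f (-x)) (fun y => ?_) (by simp)
      (by simp [d.v1_zero]) x
    have := (d.dv f (-y)).comp y (hasDerivAt_neg y)
    exact this.congr_deriv (by ring)
  have dg1 : ∀ f x, HasDerivAt (g1 f) (g2 f x) x := by
    intro f x
    have := glue_deriv (f := d.v1 f) (g := fun x => - d.v1 f (-x)) (d.dv1 f)
      (g1 := fun x => f (-x) + d.q (-x) * d.v f (-x)) (fun y => ?_) (by simp [d.v1_zero])
      (by simp) x
    · refine this.congr_deriv ?_
      simp only [g2, gabs]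
      split_ifs with h
      · rw [abs_of_nonneg h]
      · rw [abs_of_neg (not_le.1 h), d.qe]
    · have := ((d.dv1 f (-y)).comp y (hasDerivAt_neg y)).neg
      exact this.congr_deriv (by ring)
  have tabs : Tendsto (fun x : ℝ => |x|) (cocompact ℝ) atTop := tendsto_norm_cocompact_atTop
  have cg : ∀ f, Continuous (g f) := fun f =>
    continuous_iff_continuousAt.2 fun x => (dg f x).continuousAt
  have cg1 : ∀ f, Continuous (g1 f) := fun f =>
    continuous_iff_continuousAt.2 fun x => (dg1 f x).continuousAt
  have tg : ∀ f, Tendsto (g f) (cocompact ℝ) (nhds 0) := by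
    intro f
    have := (d.comb_tendsto hB hA d.bψ d.bp f).comp tabs
    refine this.congr (fun x => ?_)
    rw [gabs]; rfl
  have tg1 : ∀ f, Tendsto (g1 f) (cocompact ℝ) (nhds 0) := by
    intro f
    have := (d.comb_tendsto hB1 hA1 d.bψ1 d.bp1 f).comp tabs
    rw [tendsto_zero_iff_abs_tendsto_zero] at this ⊢
    refine this.congr (fun x => ?_)
    simp only [Function.comp]
    rw [g1abs]; rfl
  have gadd : ∀ f f' x, g (f + f') x = g f x + g f' x := by
    intro f f' x
    simp only [gabs, GD.v, d.a_add, d.b_add]; ring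
  have gsmul : ∀ (c : ℝ) f x, g (c • f) x = c * g f x := by
    intro f f' x
    simp only [gabs, GD.v, d.a_smul, d.b_smul]; ring
  have g1add : ∀ f f' x, g1 (f + f') x = g1 f x + g1 f' x := by
    intro f f' x
    simp only [g1, GD.v1, d.a_add, d.b_add]; split_ifs <;> ring
  have g1smul : ∀ (c : ℝ) f x, g1 (c • f) x = c * g1 f x := by
    intro f f' x
    simp only [g1, GD.v1, d.a_smul, d.b_smul]; split_ifs <;> ring
  have bg : ∀ f x, |g f x| ≤ 2 * d.A * d.B / d.μ * ‖f‖ := by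
    intro f x
    rw [gabs]
    have := d.comb_le hB hA d.bψ d.bp f (abs_nonneg x)
    refine this.trans_eq ?_
    ring
  have bg1 : ∀ f x, |g1 f x| ≤ (d.A * d.B1 + d.B * d.A1) / d.μ * ‖f‖ := by
    intro f x
    rw [g1abs]
    exact d.comb_le hB1 hA1 d.bψ1 d.bp1 f (abs_nonneg x)
  have hCq0 : 0 ≤ d.Cq := (abs_nonneg _).trans (d.hCq 0)
  have bg2 : ∀ f x, |g2 f x| ≤ (1 + d.Cq * (2 * d.A * d.B / d.μ)) * ‖f‖ := by
    intro f x
    have h1 := CF_abs_le f |x|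
    have h2 : |d.q x * g f x| ≤ d.Cq * (2 * d.A * d.B / d.μ * ‖f‖) := by
      rw [abs_mul]
      exact mul_le_mul (d.hCq x) (bg f x) (abs_nonneg _) hCq0
    have h3 := abs_add_le (f |x|) (d.q x * g f x)
    have : |g2 f x| = |f |x| + d.q x * g f x| := rfl
    rw [this]
    linarith
  have cg2 : ∀ f, Continuous (g2 f) := fun f =>
    (f.cont.comp continuous_abs).add (d.hq.mul (cg f))
  have tg2 : ∀ f, Tendsto (g2 f) (cocompact ℝ) (nhds 0) := by
    intro f
    have h1 : Tendsto (fun x : ℝ => f |x|) (cocompact ℝ) (nhds 0) :=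
      (f.tends.mono_left atTop_le_cocompact).comp tabs
    have h2 : Tendsto (fun x : ℝ => d.q x * g f x) (cocompact ℝ) (nhds 0) := by
      refine bdd_le_mul_tendsto_zero' d.Cq (Eventually.of_forall d.hCq) (tg f)
    simpa using h1.add h2
  have g2add : ∀ f f' x, g2 (f + f') x = g2 f x + g2 f' x := by
    intro f f' x
    simp only [g2, gadd, CF.add_apply]; ring
  have g2smul : ∀ (c : ℝ) f x, g2 (c • f) x = c * g2 f x := by
    intro f f' x
    simp only [g2, gsmul, CF.smul_apply]; ring
  have build : ∀ (g : CF → ℝ → ℝ) (M : ℝ), 0 ≤ M → (∀ f, Continuous (g f)) →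
      (∀ f, Tendsto (g f) (cocompact ℝ) (nhds 0)) → (∀ f f' x, g (f + f') x = g f x + g f' x) →
      (∀ (c : ℝ) f x, g (c • f) x = c * g f x) → (∀ f x, |g f x| ≤ M * ‖f‖) →
      ∃ G : CF →L[ℝ] CF, ‖G‖ ≤ M ∧ ∀ f, (G f : ℝ → ℝ) = g f := by
    intro g M hM hc ht ha hs hb
    let L : CF →ₗ[ℝ] CF :=
      { toFun := fun f => CF.mk' (g f) (hc f) (ht f)
        map_add' := fun f f' => CF.ext' fun x => ha f f' x
        map_smul' := fun c f => CF.ext' fun x => hs c f x }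
    refine ⟨L.mkContinuous M ?_, LinearMap.mkContinuous_norm_le _ hM _, fun f => rfl⟩
    intro f
    exact CF_norm_le _ (by positivity) (fun x => hb f x)
  obtain ⟨G, hG, eG⟩ := build g _ (by positivity) cg tg gadd gsmul bg
  obtain ⟨G1, hG1, eG1⟩ := build g1 _ (by positivity) cg1 tg1 g1add g1smul bg1
  obtain ⟨G2, hG2, eG2⟩ := build g2 _ (by positivity) cg2 tg2 g2add g2smul bg2
  refine ⟨G, G1, G2, hG, hG1, hG2, ?_, ?_, ?_, ?_, ?_⟩
  · intro f X; rw [eG, eG1]; exact dg f X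
  · intro f X; rw [eG1, eG2]; exact dg1 f X
  · intro f X; rw [eG2, eG]
  · intro f X; rw [eG, gabs, gabs, abs_neg]
  · intro f X
    rw [eG1]
    simp only [g1]
    rcases lt_trichotomy X 0 with h | h | h
    · rw [if_pos (by linarith), if_neg (by linarith)]; simp
    · subst h; simp [d.v1_zero]
    · rw [if_neg (by linarith), if_pos (by linarith)]; simp


noncomputable def constGD (μ : ℝ) (hμ : 0 < μ) : GD where
  p := fun X => exp (-μ * X)
  p1 := fun X => -μ * exp (-μ * X)
  ψ := fun X => cosh (μ * X) / μ
  ψ1 := fun X => sinh (μ * X)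
  q := fun _ => μ ^ 2
  μ := μ
  A := 1
  A1 := μ
  B := 1 / μ
  B1 := 1
  Cq := μ ^ 2
  hp := fun X => by
    have := ((hasDerivAt_id X).const_mul (-μ)).exp
    exact this.congr_deriv (by simp; ring)
  hp1 := fun X => by
    have := (((hasDerivAt_id X).const_mul (-μ)).exp).const_mul (-μ)
    exact this.congr_deriv (by simp; ring)
  hψ := fun X => by
    have := (((hasDerivAt_id X).const_mul μ).cosh).div_const μ
    exact this.congr_deriv (by simp; field_simp)
  hψ1 := fun X => by
    have := (((hasDerivAt_id X).const_mul μ).sinh)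
    exact this.congr_deriv (by simp; field_simp)
  hW := fun X => by
    have : exp (-μ * X) * exp (μ * X) = 1 := by rw [← exp_add]; simp
    rw [← cosh_add_sinh (μ * X), neg_mul] at this
    field_simp
    linear_combination this
  h0 := by simp
  hμ := hμ
  hA := zero_le_one
  hA1 := hμ.le
  hB := by positivity
  hB1 := zero_le_one
  bp := fun X _ => by simp
  bp1 := fun X _ => by simp [abs_mul, abs_of_pos hμ]
  bψ := fun X hX => by
    rw [abs_of_nonneg (by have := cosh_pos (μ * X); positivity), div_eq_inv_mul, one_div]
    have : cosh (μ * X) ≤ exp (μ * X) := by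
      rw [← cosh_add_sinh]
      have : 0 ≤ sinh (μ * X) := sinh_nonneg_iff.2 (by positivity)
      linarith
    gcongr
  bψ1 := fun X hX => by
    have h1 : 0 ≤ sinh (μ * X) := sinh_nonneg_iff.2 (by positivity)
    rw [abs_of_nonneg h1, one_mul, ← cosh_add_sinh]
    have := cosh_pos (μ * X)
    linarith
  hCq := fun X => by rw [abs_of_nonneg (by positivity)]
  hq := continuous_const
  qe := fun _ => rfl

theorem cosh_inv_le (X : ℝ) : 1 / cosh X ≤ 2 * exp (-X) := by
  rw [div_le_iff₀ (cosh_pos X)]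
  have h1 : exp (-X) * exp X = 1 := by rw [← exp_add]; simp
  rw [cosh_eq]
  nlinarith [exp_pos (-X)]

theorem p_bd (X : ℝ) : |sinh X / cosh X ^ 2| ≤ 1 / cosh X := by
  have hc := cosh_pos X
  rw [abs_div, abs_of_pos (show 0 < cosh X ^ 2 by positivity), div_le_div_iff₀ (by positivity) hc]
  have : |sinh X| ≤ cosh X := abs_le_of_sq_le_sq (by nlinarith [cosh_sq X]) hc.le
  nlinarith

theorem p1_bd (X : ℝ) : |(cosh X ^ 2 - 2 * sinh X ^ 2) / cosh X ^ 3| ≤ 3 / cosh X := by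
  have hc := cosh_pos X
  rw [abs_div, abs_of_pos (show 0 < cosh X ^ 3 by positivity), div_le_div_iff₀ (by positivity) hc]
  have : |cosh X ^ 2 - 2 * sinh X ^ 2| ≤ 3 * cosh X ^ 2 := by
    rw [abs_le]; constructor <;> nlinarith [cosh_sq X, sq_nonneg (sinh X)]
  nlinarith

theorem d_p (X : ℝ) : HasDerivAt (fun X => sinh X / cosh X ^ 2)
    ((cosh X ^ 2 - 2 * sinh X ^ 2) / cosh X ^ 3) X := by
  have hc := (cosh_pos X).ne'
  have := (hasDerivAt_sinh X).div ((hasDerivAt_cosh X).pow 2) (pow_ne_zero 2 hc)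
  refine this.congr_deriv ?_
  simp only [Pi.pow_apply]
  field_simp
  push_cast
  ring

theorem d_p1 (X : ℝ) : HasDerivAt (fun X => (cosh X ^ 2 - 2 * sinh X ^ 2) / cosh X ^ 3)
    ((1 - 6 / cosh X ^ 2) * (sinh X / cosh X ^ 2)) X := by
  have hc := (cosh_pos X).ne'
  have := (((hasDerivAt_cosh X).pow 2).sub (((hasDerivAt_sinh X).pow 2).const_mul 2)).div
    ((hasDerivAt_cosh X).pow 3) (pow_ne_zero 3 hc)
  refine this.congr_deriv ?_
  have h2 : cosh X ^ 2 = sinh X ^ 2 + 1 := cosh_sq X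
  simp only [Pi.pow_apply, Pi.sub_apply]
  field_simp
  push_cast
  ring_nf
  have h4 : cosh X ^ 4 = (sinh X ^ 2 + 1) ^ 2 := by rw [← h2]; ring
  try rw [h4]
  try rw [h2]
  ring

theorem d_sech (X : ℝ) : HasDerivAt (fun X => 1 / cosh X) (-(sinh X / cosh X ^ 2)) X := by
  have hc := (cosh_pos X).ne'
  have := (hasDerivAt_const X (1:ℝ)).div (hasDerivAt_cosh X) hc
  refine this.congr_deriv ?_
  simp; ring

noncomputable def psi0 (X : ℝ) : ℝ := - (1 / cosh X) + 3 / 2 * (X * (sinh X / cosh X ^ 2)) +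
  1 / 2 * (cosh X - 1 / cosh X)
noncomputable def psi1 (X : ℝ) : ℝ := 3 * (sinh X / cosh X ^ 2) + 1 / 2 * sinh X +
  3 / 2 * (X * ((cosh X ^ 2 - 2 * sinh X ^ 2) / cosh X ^ 3))

theorem d_psi0 (X : ℝ) : HasDerivAt psi0 (psi1 X) X := by
  have := ((d_sech X).neg.add (((hasDerivAt_id X).mul (d_p X)).const_mul (3/2))).add
    (((hasDerivAt_cosh X).sub (d_sech X)).const_mul (1/2))
  refine this.congr_deriv ?_
  simp only [psi1, id]
  ring

theorem d_psi1 (X : ℝ) : HasDerivAt psi1 ((1 - 6 / cosh X ^ 2) * psi0 X) X := by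
  have hc := (cosh_pos X).ne'
  have := (((d_p X).const_mul 3).add ((hasDerivAt_sinh X).const_mul (1/2))).add
    (((hasDerivAt_id X).mul (d_p1 X)).const_mul (3/2))
  refine this.congr_deriv ?_
  have h2 : sinh X ^ 2 = cosh X ^ 2 - 1 := by rw [cosh_sq]; ring
  simp only [psi0, id]
  rw [h2]
  field_simp
  ring

noncomputable def L0GD : GD where
  p := fun X => sinh X / cosh X ^ 2
  p1 := fun X => (cosh X ^ 2 - 2 * sinh X ^ 2) / cosh X ^ 3
  ψ := psi0
  ψ1 := psi1
  q := fun X => 1 - 6 / cosh X ^ 2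
  μ := 1
  A := 2
  A1 := 6
  B := 10
  B1 := 10
  Cq := 7
  hp := d_p
  hp1 := d_p1
  hψ := d_psi0
  hψ1 := d_psi1
  hW := fun X => by
    have hc := (cosh_pos X).ne'
    have h2 : sinh X ^ 2 = cosh X ^ 2 - 1 := by rw [cosh_sq]; ring
    have h4 : sinh X ^ 4 = (cosh X ^ 2 - 1) ^ 2 := by rw [← h2]; ring
    simp only [psi0, psi1]
    field_simp
    ring_nf
    try rw [h4]
    try rw [h2]
    ring
  h0 := by simp [psi1]
  hμ := one_pos
  hA := by norm_num
  hA1 := by norm_num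
  hB := by norm_num
  hB1 := by norm_num
  bp := fun X _ => by
    have := (p_bd X).trans (cosh_inv_le X)
    simpa using this
  bp1 := fun X _ => by
    have h1 := p1_bd X
    have h2 := cosh_inv_le X
    have : 3 / cosh X = 3 * (1 / cosh X) := by ring
    rw [neg_one_mul]
    linarith
  bψ := fun X hX => by
    have h1 := p_bd X
    have h3 : 1 / cosh X ≤ 1 := by
      rw [div_le_one (cosh_pos X)]; exact one_le_cosh X
    have h3' : 0 < 1 / cosh X := by have := cosh_pos X; positivity
    have h4 : X + 1 ≤ exp X := add_one_le_exp X
    have h5 : cosh X ≤ exp X := by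
      have := sinh_nonneg_iff.2 hX
      rw [← cosh_add_sinh]; linarith
    have h6 : |X * (sinh X / cosh X ^ 2)| ≤ X := by
      rw [abs_mul, abs_of_nonneg hX]
      exact mul_le_of_le_one_right hX (h1.trans h3)
    rw [abs_le] at h6
    have h7 := cosh_pos X
    rw [one_mul, psi0, abs_le]
    constructor <;> linarith
  bψ1 := fun X hX => by
    have h1 := p_bd X
    have h1' := p1_bd X
    have h3 : 1 / cosh X ≤ 1 := by
      rw [div_le_one (cosh_pos X)]; exact one_le_cosh X
    have h3' : 0 < 1 / cosh X := by have := cosh_pos X; positivity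
    have h33 : 3 / cosh X = 3 * (1 / cosh X) := by ring
    have h4 : X + 1 ≤ exp X := add_one_le_exp X
    have h5 : sinh X ≤ exp X := by
      have := cosh_pos X
      rw [← cosh_add_sinh]; linarith
    have h5' := sinh_nonneg_iff.2 hX
    have h6 : |X * ((cosh X ^ 2 - 2 * sinh X ^ 2) / cosh X ^ 3)| ≤ X * 3 := by
      rw [abs_mul, abs_of_nonneg hX]
      exact mul_le_mul_of_nonneg_left (by linarith) hX
    rw [abs_le] at h6
    have h8 := h1.trans h3
    rw [abs_le] at h8
    rw [one_mul, psi1, abs_le]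
    constructor <;> linarith
  hCq := fun X => by
    have hc := one_le_cosh X
    have h1 : 6 / cosh X ^ 2 ≤ 6 := by
      rw [div_le_iff₀ (by positivity)]; nlinarith
    have h2 : 0 ≤ 6 / cosh X ^ 2 := by positivity
    rw [abs_le]; constructor <;> linarith
  hq := by
    refine continuous_const.sub (continuous_const.div (by fun_prop) ?_)
    intro X; exact pow_ne_zero 2 (cosh_pos X).ne'
  qe := fun X => by simp

theorem sech_tends : Tendsto (fun X => 1 / cosh X) (cocompact ℝ) (nhds 0) := by
  have tabs : Tendsto (fun x : ℝ => |x|) (cocompact ℝ) atTop := tendsto_norm_cocompact_atTop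
  have h1 : Tendsto (fun x : ℝ => 2 * exp (-|x|)) (cocompact ℝ) (nhds 0) := by
    have := (Real.tendsto_exp_neg_atTop_nhds_zero.comp tabs).const_mul 2
    simpa using this
  refine squeeze_zero (fun X => ?_) (fun X => ?_) h1
  · have := cosh_pos X; positivity
  · rw [← cosh_abs]; exact cosh_inv_le _

noncomputable def s0 : CF := CF.mk' (fun X => 1 / cosh X)
  (continuous_iff_continuousAt.2 fun X => (d_sech X).continuousAt) sech_tends

noncomputable def s1 : CF := - CF.mk' (fun X => sinh X / cosh X ^ 2)
  (continuous_iff_continuousAt.2 fun X => (d_p X).continuousAt)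
  (by
    rw [tendsto_zero_iff_abs_tendsto_zero]
    exact squeeze_zero (fun X => abs_nonneg _) p_bd sech_tends)

noncomputable def s2 : CF := s0 - (2:ℝ) • (s0 * s0 * s0)

theorem s0_apply (X : ℝ) : s0 X = 1 / cosh X := rfl
theorem s1_apply (X : ℝ) : s1 X = - (sinh X / cosh X ^ 2) := rfl
theorem s2_apply (X : ℝ) : s2 X = s0 X - 2 * s0 X ^ 3 := by
  rw [s2, CF.sub_apply, CF.smul_apply, CF.mul_apply, CF.mul_apply]; ring

theorem d_s0 (X : ℝ) : HasDerivAt s0 (s1 X) X := d_sech X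
theorem d_s1 (X : ℝ) : HasDerivAt s1 (s2 X) X := by
  have := (d_p X).neg
  refine this.congr_deriv ?_
  have hc := (cosh_pos X).ne'
  have h2 : sinh X ^ 2 = cosh X ^ 2 - 1 := by rw [cosh_sq]; ring
  rw [s2_apply, s0_apply, h2]
  field_simp
  ring

theorem s0_even : rfn s0 = s0 := CF.ext' fun X => by
  rw [rfn_apply, s0_apply, s0_apply, cosh_neg]
theorem s1_odd : rfn s1 = - s1 := CF.ext' fun X => by
  rw [rfn_apply, CF.neg_apply, s1_apply, s1_apply, cosh_neg, sinh_neg]; ring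
theorem s2_even : rfn s2 = s2 := CF.ext' fun X => by
  rw [rfn_apply, s2_apply, s2_apply, s0_apply, s0_apply, cosh_neg]


theorem c1_of_partials {f f1 f2 : ℝ × ℝ → ℝ}
    (h1 : ∀ x y, HasDerivAt (fun t => f (t, y)) (f1 (x, y)) x)
    (h2 : ∀ x y, HasDerivAt (fun t => f (x, t)) (f2 (x, y)) y)
    (c1 : Continuous f1) (c2 : Continuous f2) (p : ℝ × ℝ) :
    HasFDerivAt f (f1 p • ContinuousLinearMap.fst ℝ ℝ ℝ + f2 p • ContinuousLinearMap.snd ℝ ℝ ℝ) p := by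
  have := hasStrictFDerivAt_uncurry_coprod (𝕜 := ℝ) (u := p) (f := fun x y => f (x, y))
    (f₁ := fun x y => ContinuousLinearMap.toSpanSingleton ℝ (f1 (x, y)))
    (f₂ := fun x y => ContinuousLinearMap.toSpanSingleton ℝ (f2 (x, y)))
    (Eventually.of_forall fun q => (h1 q.1 q.2).hasFDerivAt)
    (Eventually.of_forall fun q => (h2 q.1 q.2).hasFDerivAt)
    (by
      have : Continuous (fun q : ℝ × ℝ => ContinuousLinearMap.toSpanSingleton ℝ (f1 q)) :=
        (ContinuousLinearMap.toSpanSingletonCLE (𝕜 := ℝ) (E := ℝ)).continuous.comp c1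
      exact this.continuousAt)
    (by
      have : Continuous (fun q : ℝ × ℝ => ContinuousLinearMap.toSpanSingleton ℝ (f2 q)) :=
        (ContinuousLinearMap.toSpanSingletonCLE (𝕜 := ℝ) (E := ℝ)).continuous.comp c2
      exact this.continuousAt)
  refine this.hasFDerivAt.congr_fderiv ?_
  ext <;> simp [Function.HasUncurry.uncurry]

theorem cd1_of_partials {f f1 f2 : ℝ × ℝ → ℝ}
    (h1 : ∀ x y, HasDerivAt (fun t => f (t, y)) (f1 (x, y)) x)
    (h2 : ∀ x y, HasDerivAt (fun t => f (x, t)) (f2 (x, y)) y)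
    (c1 : Continuous f1) (c2 : Continuous f2) : ContDiff ℝ 1 f := by
  rw [contDiff_one_iff_hasFDerivAt]
  refine ⟨_, ?_, c1_of_partials h1 h2 c1 c2⟩
  fun_prop

theorem cd2_of_partials {f f1 f2 : ℝ × ℝ → ℝ}
    (h1 : ∀ x y, HasDerivAt (fun t => f (t, y)) (f1 (x, y)) x)
    (h2 : ∀ x y, HasDerivAt (fun t => f (x, t)) (f2 (x, y)) y)
    (c1 : ContDiff ℝ 1 f1) (c2 : ContDiff ℝ 1 f2) : ContDiff ℝ 2 f := by
  have := (contDiff_succ_iff_hasFDerivAt (𝕜 := ℝ) (n := 1) (f := f)).2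
    ⟨_, ?_, c1_of_partials h1 h2 c1.continuous c2.continuous⟩
  · exact this
  · have : ContDiff ℝ 1 (fun p : ℝ × ℝ => f1 p • ContinuousLinearMap.fst ℝ ℝ ℝ
      + f2 p • ContinuousLinearMap.snd ℝ ℝ ℝ) := by fun_prop
    exact this

structure Sol (η C : ℝ) where
  (v vx vy vxx vxy vyy : ℝ × ℝ → ℝ)
  dx : ∀ x y, HasDerivAt (fun t => v (t, y)) (vx (x, y)) x
  dy : ∀ x y, HasDerivAt (fun t => v (x, t)) (vy (x, y)) y
  dxx : ∀ x y, HasDerivAt (fun t => vx (t, y)) (vxx (x, y)) x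
  dxy : ∀ x y, HasDerivAt (fun t => vx (x, t)) (vxy (x, y)) y
  dyx : ∀ x y, HasDerivAt (fun t => vy (t, y)) (vxy (x, y)) x
  dyy : ∀ x y, HasDerivAt (fun t => vy (x, t)) (vyy (x, y)) y
  cxx : Continuous vxx
  cxy : Continuous vxy
  cyy : Continuous vyy
  K : ℝ
  b : ∀ p, |v p| ≤ K
  bx : ∀ p, |vx p| ≤ K
  by' : ∀ p, |vy p| ≤ K
  bxx : ∀ p, |vxx p| ≤ K
  bxy : ∀ p, |vxy p| ≤ K
  byy : ∀ p, |vyy p| ≤ K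
  pde : ∀ p, vxx p + vyy p + v p - η ^ 2 * v p = 8 / 3 * η ^ 2 * (3 * vx p ^ 2 * vxx p +
    vy p ^ 2 * vxx p + 4 * vx p * vy p * vxy p + vx p ^ 2 * vyy p + 3 * vy p ^ 2 * vyy p)
  bdl : ∀ x, v (x, -(π / 2)) = 0
  bdr : ∀ x, v (x, π / 2) = 0
  close : ∀ x y, |v (x, y) - (cosh (η * x))⁻¹ * cos y| ≤ C * η
  decay : ∀ δ > 0, ∃ X : ℝ, ∀ x, X ≤ |x| → ∀ y, |v (x, y)| ≤ δ


theorem ES_summable (a : ES) : Summable (fun k => ‖a k‖) := (ES_hasSum_norm a).summable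

theorem ev_tsum (x y : ℝ) (a : ES) : ev x y a = ∑' k, (a k x : ℂ) * ek k y :=
  (ev_hasSum x y a).tsum_eq.symm

theorem term_le (a : ES) (k : ℤ) (x y : ℝ) : ‖(a k x : ℂ) * ek k y‖ ≤ ‖a k‖ := by
  rw [norm_mul, ek_norm, mul_one, Complex.norm_real]
  exact CF_abs_le _ _

theorem ek_cont (k : ℤ) : Continuous (ek k) := by
  unfold ek; fun_prop

theorem ev_cont (η : ℝ) (a : ES) : Continuous (fun p : ℝ × ℝ => ev (η * p.1) p.2 a) := by
  simp only [ev_tsum]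
  refine continuous_tsum (fun k => ?_) (ES_summable a) (fun k p => term_le a k _ _)
  refine Continuous.mul (Complex.continuous_ofReal.comp ((a k).cont.comp (by fun_prop)))
    ((ek_cont k).comp continuous_snd)

theorem ev_dx {η : ℝ} {a a' : ES}
    (h : ∀ k x, HasDerivAt (fun x => a k (η * x)) (a' k (η * x)) x) (x y : ℝ) :
    HasDerivAt (fun x => ev (η * x) y a) (ev (η * x) y a') x := by
  simp only [ev_tsum]
  refine hasDerivAt_tsum (𝕜 := ℝ) (u := fun k => ‖a' k‖) (g := fun k x => (a k (η * x) : ℂ) * ek k y)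
    (g' := fun k x => (a' k (η * x) : ℂ) * ek k y)
    (y₀ := 0) (ES_summable a') ?_ (fun k x => term_le a' k _ _) ?_ x
  · intro k x
    exact ((h k x).ofReal_comp).mul_const _
  · exact (ev_hasSum _ _ a).summable

theorem ek_deriv (k : ℤ) (y : ℝ) : HasDerivAt (ek k) (Complex.I * (k * ek k y)) y := by
  have h0 : HasDerivAt (fun y : ℝ => (((k : ℝ) * y : ℝ) : ℂ) * Complex.I) ((k : ℂ) * Complex.I) y := by
    have := (((hasDerivAt_id y).const_mul (k : ℝ)).ofReal_comp).mul_const Complex.I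
    refine this.congr_deriv ?_
    simp
  have := h0.cexp
  refine this.congr_deriv ?_
  rw [ek]; ring

theorem ev_dy {a b : ES} (h : ∀ k x, b k x = (k : ℝ) * a k x) (x y : ℝ) :
    HasDerivAt (fun y => ev x y a) (Complex.I * ev x y b) y := by
  simp only [ev_tsum]
  rw [← tsum_mul_left]
  refine hasDerivAt_tsum (𝕜 := ℝ) (u := fun k => ‖b k‖) (g := fun k y => (a k x : ℂ) * ek k y)
    (g' := fun k y => Complex.I * ((b k x : ℂ) * ek k y))
    (y₀ := 0) (ES_summable b) ?_ (fun k y => ?_) ?_ y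
  · intro k y
    refine ((ek_deriv k y).const_mul _).congr_deriv ?_
    rw [h]; push_cast; ring
  · rw [norm_mul, Complex.norm_I, one_mul]
    exact term_le b k _ _
  · exact (ev_hasSum _ _ a).summable

theorem ek_conj (k : ℤ) (y : ℝ) : (starRingEnd ℂ) (ek k y) = ek (-k) y := by
  rw [ek, ek, ← Complex.exp_conj]; simp

theorem ev_conj (x y : ℝ) (a : ES) : (starRingEnd ℂ) (ev x y a) = ev x y (Jk a) := by
  have h1 : HasSum (fun k => (starRingEnd ℂ) ((a k x : ℂ) * ek k y)) ((starRingEnd ℂ) (ev x y a)) :=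
    Complex.hasSum_conj'.2 (by simpa using ev_hasSum x y a)
  have h2 := (Equiv.neg ℤ).hasSum_iff.2 h1
  refine h2.unique ?_
  convert ev_hasSum x y (Jk a) using 2 with k
  simp [ek_conj, Jk_apply]

theorem ev_real {a : ES} (h : Jk a = a) (x y : ℝ) : ((ev x y a).re : ℂ) = ev x y a := by
  have := ev_conj x y a
  rw [h] at this
  exact Complex.conj_eq_iff_re.1 this

theorem ev_imag {a : ES} (h : Jk a = -a) (x y : ℝ) :
    (((Complex.I * ev x y a).re : ℝ) : ℂ) = Complex.I * ev x y a := by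
  have := ev_conj x y a
  rw [h, map_neg] at this
  refine Complex.conj_eq_iff_re.1 ?_
  rw [map_mul, this, Complex.conj_I]; ring

theorem ev_bdy {a : ES} (hJ : Jk a = a) (hP : Pk a = -a) (x : ℝ) {y : ℝ}
    (hy : ∀ k : ℤ, ¬ Even k → ek k y + ek (-k) y = 0) : ev x y a = 0 := by
  have h1 := ev_hasSum x y a
  have h2 := (Equiv.neg ℤ).hasSum_iff.2 h1
  have h3 := h1.add h2
  have h4 : ev x y a + ev x y a = 0 := by
    refine h3.unique ?_
    have : (fun b => (a b x : ℂ) * ek b y +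
        ((fun k => (a k x : ℂ) * ek k y) ∘ (Equiv.neg ℤ)) b) = fun _ => 0 := by
      funext k
      simp only [Function.comp, Equiv.neg_apply]
      have e1 : a (-k) = a k := by rw [← Jk_apply, hJ]
      rw [e1, ← mul_add]
      by_cases hk : Even k
      · have e2 := Pk_apply a k
        rw [hP, sgnk, if_pos hk, one_smul] at e2
        have e3 : (a k) x = 0 := by
          have := congrArg (fun f : CF => f x) e2
          have e4 : (-a) k = - a k := rfl
          simp only [e4, CF.neg_apply] at this
          linarith
        rw [e3]; simp
      · rw [hy k hk, mul_zero]
    rw [this]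
    exact hasSum_zero
  linear_combination (1/2 : ℂ) * h4

theorem ek_cos (k : ℤ) (y : ℝ) : ek k y + ek (-k) y = 2 * (cos (k * y) : ℂ) := by
  rw [Complex.ofReal_cos, Complex.cos, ek, ek]; push_cast; ring_nf

theorem ek_half {k : ℤ} (hk : ¬ Even k) : ek k (π / 2) + ek (-k) (π / 2) = 0 := by
  rw [Int.not_even_iff_odd] at hk
  obtain ⟨j, rfl⟩ := hk
  rw [ek_cos]
  have : cos (((2 * j + 1 : ℤ) : ℝ) * (π / 2)) = 0 := by
    rw [cos_eq_zero_iff]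
    exact ⟨j, by push_cast; ring⟩
  rw [this]; simp

theorem ek_nhalf {k : ℤ} (hk : ¬ Even k) : ek k (-(π / 2)) + ek (-k) (-(π / 2)) = 0 := by
  have h := ek_half hk
  have e : ∀ k : ℤ, ek k (-(π / 2)) = ek (-k) (π / 2) := by
    intro k; rw [ek, ek]; push_cast; ring_nf
  rw [e, e, neg_neg, add_comm]; exact h

theorem ev_decay (a : ES) (δ : ℝ) (hδ : 0 < δ) : ∃ X : ℝ, ∀ x, X ≤ |x| → ∀ y, ‖ev x y a‖ ≤ δ := by
  have h : Tendsto (fun x => ∑' k, |a k x|) (cocompact ℝ) (nhds (∑' k : ℤ, (0:ℝ))) := by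
    refine tendsto_tsum_of_dominated_convergence (bound := fun k => ‖a k‖) (ES_summable a) ?_ ?_
    · intro k
      exact (tendsto_zero_iff_abs_tendsto_zero _).1 (a k).tends
    · refine Eventually.of_forall fun x k => ?_
      rw [Real.norm_eq_abs, abs_abs]; exact CF_abs_le _ _
  rw [tsum_zero] at h
  have h2 := h.eventually (gt_mem_nhds hδ)
  rw [← Metric.cobounded_eq_cocompact, ← comap_norm_atTop] at h2
  rw [eventually_comap, eventually_atTop] at h2
  obtain ⟨X, hX⟩ := h2
  refine ⟨X, fun x hx y => ?_⟩
  have h3 := hX |x| hx x rfl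
  rw [ev_tsum]
  have hs : Summable fun k => |a k x| :=
    Summable.of_nonneg_of_le (fun _ => abs_nonneg _) (fun k => CF_abs_le _ _) (ES_summable a)
  have hn : ∀ k, ‖(a k x : ℂ) * ek k y‖ = |a k x| := by
    intro k
    rw [norm_mul, ek_norm, mul_one, Complex.norm_real, Real.norm_eq_abs]
  have := norm_tsum_le_tsum_norm (f := fun k => (a k x : ℂ) * ek k y) (by simp only [hn]; exact hs)
  simp only [hn] at this
  linarith


theorem ES_coord_ext {a b : ES} (h : ∀ k x, a k x = b k x) : a = b :=
  lp.ext (funext fun k => CF.ext' (h k))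
theorem ES_add_apply (a b : ES) (k : ℤ) : (a + b) k = a k + b k := rfl
theorem ES_sub_apply (a b : ES) (k : ℤ) : (a - b) k = a k - b k := rfl
theorem ES_neg_apply (a : ES) (k : ℤ) : (-a) k = - a k := rfl
theorem ES_smul_apply (c : ℝ) (a : ES) (k : ℤ) : (c • a) k = c • a k := rfl

noncomputable def dl (f : CF) : ES := sg 1 f + sg (-1) f
noncomputable def dm (f : CF) : ES := sg 1 f - sg (-1) f

theorem dl_apply (f : CF) (k : ℤ) : dl f k = if k.natAbs = 1 then f else 0 := by
  rw [dl, ES_add_apply]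
  split_ifs with h
  · rcases Int.natAbs_eq_iff.1 h with h | h
    · simp only [Nat.cast_one] at h; subst h
      rw [sg_same, sg_ne (by decide), add_zero]
    · simp only [Nat.cast_one] at h; subst h
      rw [sg_same, sg_ne (by decide), zero_add]
  · rw [sg_ne (by rintro rfl; simp at h), sg_ne (by rintro rfl; simp at h), add_zero]

theorem dm_apply (f : CF) (k : ℤ) : dm f k = if k.natAbs = 1 then (k : ℝ) • f else 0 := by
  rw [dm, ES_sub_apply]
  split_ifs with h
  · rcases Int.natAbs_eq_iff.1 h with h | h
    · simp only [Nat.cast_one] at h; subst h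
      rw [sg_same, sg_ne (by decide)]; simp
    · simp only [Nat.cast_one] at h; subst h
      rw [sg_same, sg_ne (by decide)]; simp
  · rw [sg_ne (by rintro rfl; simp at h), sg_ne (by rintro rfl; simp at h), sub_zero]

theorem tri_dm (a b c : CF) : tri (dm a) (dm b) (dl c) =
    sg 3 (a * b * c) - sg 1 (a * b * c) - sg (-1) (a * b * c) + sg (-3) (a * b * c) := by
  simp only [tri, dm, dl, map_add, map_sub, add_apply, sub_apply, cv_sg]
  norm_num
  abel

theorem tri_dm_apply (a b c : CF) {k : ℤ} (hk : k.natAbs = 1) :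
    (tri (dm a) (dm b) (dl c)) k = - (a * b * c) := by
  rw [tri_dm]
  simp only [ES_add_apply, ES_sub_apply]
  rcases Int.natAbs_eq_iff.1 hk with h | h
  · simp only [Nat.cast_one] at h; subst h
    rw [sg_same, sg_ne (by decide), sg_ne (by decide), sg_ne (by decide)]; simp
  · simp only [Nat.cast_one] at h; subst h
    rw [sg_same, sg_ne (by decide), sg_ne (by decide), sg_ne (by decide)]; simp

theorem tri_neg (a b c : ES) : tri a b (-c) = - tri a b c := by
  simp only [tri, map_neg]

theorem high_mode (η : ℝ) (hη : 0 < η) (hη1 : η ≤ 1) (n : ℕ) (hn : 2 ≤ n) :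
    ∃ O O1 O2 : CF →L[ℝ] CF,
      (∀ f X, HasDerivAt (O f) (O1 f X) X) ∧ (∀ f X, HasDerivAt (O1 f) (O2 f X) X) ∧
      (∀ f X, O f (-X) = O f X) ∧ (∀ f X, O1 f (-X) = - O1 f X) ∧ (∀ f X, O2 f (-X) = O2 f X) ∧
      (∀ f, rfn f = f → ∀ X, η ^ 2 * O2 f X - ((n:ℝ) ^ 2 - 1 + η ^ 2) * O f X = η * f X) ∧
      (n:ℝ) ^ 2 * ‖O‖ ≤ 300 * η ∧ (n:ℝ) * ‖O1‖ ≤ 300 ∧ η ^ 2 * ‖O2‖ ≤ 300 * η := by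
  have hn' : (2:ℝ) ≤ n := by exact_mod_cast hn
  have hpos : 0 < (n:ℝ) ^ 2 - 1 + η ^ 2 := by nlinarith
  set ρ := sqrt ((n:ℝ) ^ 2 - 1 + η ^ 2) with hρ
  have hρ0 : 0 < ρ := sqrt_pos.2 hpos
  have hρ2 : ρ ^ 2 = (n:ℝ) ^ 2 - 1 + η ^ 2 := sq_sqrt hpos.le
  have hρn : (n:ℝ) / 2 ≤ ρ := by
    apply le_sqrt_of_sq_le; nlinarith
  obtain ⟨G, G1, G2, bG, bG1, bG2, d1, d2, e2, ev0, od1⟩ :=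
    (constGD (ρ / η) (by positivity)).exists_green
  simp only [constGD] at bG bG1 bG2 e2
  have bG' : ‖G‖ ≤ 2 * η ^ 2 / ρ ^ 2 := by refine bG.trans_eq ?_; field_simp
  have bG1' : ‖G1‖ ≤ 2 * η / ρ := by refine bG1.trans_eq ?_; field_simp; norm_num
  have bG2' : ‖G2‖ ≤ 3 := by refine bG2.trans_eq ?_; field_simp; norm_num
  have hs : ‖η⁻¹‖ = η⁻¹ := by rw [Real.norm_eq_abs, abs_of_pos (by positivity)]
  refine ⟨η⁻¹ • G, η⁻¹ • G1, η⁻¹ • G2, ?_, ?_, ?_, ?_, ?_, ?_, ?_, ?_, ?_⟩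
  · intro f X; exact (d1 f X).const_mul η⁻¹
  · intro f X; exact (d2 f X).const_mul η⁻¹
  · intro f X
    simp only [smul_apply, CF.smul_apply, ev0]
  · intro f X
    simp only [smul_apply, CF.smul_apply, od1]; ring
  · intro f X
    simp only [smul_apply, CF.smul_apply, e2, ev0, abs_neg]
  · intro f hf X
    simp only [smul_apply, CF.smul_apply, e2, ← hρ2]
    have : f |X| = f X := by
      rcases abs_choice X with h | h
      · rw [h]
      · rw [h, ← rfn_apply, hf]
    rw [this]
    field_simp
    ring
  · rw [norm_smul, hs]
    calc (n:ℝ) ^ 2 * (η⁻¹ * ‖G‖) ≤ (2 * ρ) ^ 2 * (η⁻¹ * (2 * η ^ 2 / ρ ^ 2)) := by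
          gcongr; linarith
      _ = 8 * η := by field_simp; norm_num
      _ ≤ 300 * η := by linarith
  · rw [norm_smul, hs]
    calc (n:ℝ) * (η⁻¹ * ‖G1‖) ≤ (2 * ρ) * (η⁻¹ * (2 * η / ρ)) := by
          gcongr; linarith
      _ = 4 := by field_simp; norm_num
      _ ≤ 300 := by norm_num
  · rw [norm_smul, hs]
    calc η ^ 2 * (η⁻¹ * ‖G2‖) ≤ η ^ 2 * (η⁻¹ * 3) := by gcongr
      _ = 3 * η := by field_simp
      _ ≤ 300 * η := by linarith

structure KD where
  (K K1 K2 : CF →L[ℝ] CF)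
  bK : ‖K‖ ≤ 300
  bK1 : ‖K1‖ ≤ 300
  bK2 : ‖K2‖ ≤ 300
  d1 : ∀ f X, HasDerivAt (K f) (K1 f X) X
  d2 : ∀ f X, HasDerivAt (K1 f) (K2 f X) X
  e0 : ∀ f X, K f (-X) = K f X
  e1 : ∀ f X, K1 f (-X) = - K1 f X
  e2 : ∀ f X, K2 f (-X) = K2 f X
  ode : ∀ f, rfn f = f → ∀ X, K2 f X = f X + (1 - 6 * s0 X ^ 2) * K f X

theorem exists_KD : Nonempty KD := by
  obtain ⟨G, G1, G2, bG, bG1, bG2, d1, d2, e2, ev0, od1⟩ := L0GD.exists_green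
  simp only [L0GD] at bG bG1 bG2 e2
  refine ⟨⟨G, G1, G2, by linarith, by linarith, by linarith, d1, d2, ev0, od1, ?_, ?_⟩⟩
  · intro f X
    simp only [e2, ev0, abs_neg, cosh_neg]
  · intro f hf X
    have : f |X| = f X := by
      rcases abs_choice X with h | h
      · rw [h]
      · rw [h, ← rfn_apply, hf]
    rw [e2, this, s0_apply]
    ring

structure Fam (η : ℝ) (κ : KD) where
  (O O1 O2 : ℕ → (CF →L[ℝ] CF))
  one0 : O 1 = κ.K
  one1 : O1 1 = κ.K1
  one2 : O2 1 = κ.K2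
  zero0 : O 0 = 0
  zero2 : O2 0 = 0
  d1 : ∀ n f X, HasDerivAt (O n f) (O1 n f X) X
  d2 : ∀ n f X, HasDerivAt (O1 n f) (O2 n f X) X
  e0 : ∀ n f X, O n f (-X) = O n f X
  e1 : ∀ n f X, O1 n f (-X) = - O1 n f X
  e2 : ∀ n f X, O2 n f (-X) = O2 n f X
  ode : ∀ n : ℕ, 2 ≤ n → ∀ f, rfn f = f → ∀ X,
    η ^ 2 * O2 n f X - ((n:ℝ) ^ 2 - 1 + η ^ 2) * O n f X = η * f X
  b0 : ∀ n : ℕ, n ≠ 1 → (n:ℝ) ^ 2 * ‖O n‖ ≤ 300 * η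
  b1 : ∀ n : ℕ, (n:ℝ) * ‖O1 n‖ ≤ 300
  b2 : ∀ n, η ^ 2 * ‖O2 n‖ ≤ 300 * η
  bb0 : ∀ n, ‖O n‖ ≤ 300
  bb1 : ∀ n, ‖O1 n‖ ≤ 300

theorem exists_Fam (κ : KD) (η : ℝ) (hη : 0 < η) (hη1 : η ≤ 1) : Nonempty (Fam η κ) := by
  have hη2 : η ^ 2 ≤ η := by nlinarith
  have hall : ∀ n : ℕ, ∃ O O1 O2 : CF →L[ℝ] CF,
      (n = 1 → O = κ.K ∧ O1 = κ.K1 ∧ O2 = κ.K2) ∧ (n = 0 → O = 0 ∧ O2 = 0) ∧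
      (∀ f X, HasDerivAt (O f) (O1 f X) X) ∧ (∀ f X, HasDerivAt (O1 f) (O2 f X) X) ∧
      (∀ f X, O f (-X) = O f X) ∧ (∀ f X, O1 f (-X) = - O1 f X) ∧ (∀ f X, O2 f (-X) = O2 f X) ∧
      (2 ≤ n → ∀ f, rfn f = f → ∀ X, η ^ 2 * O2 f X - ((n:ℝ) ^ 2 - 1 + η ^ 2) * O f X = η * f X) ∧
      (n ≠ 1 → (n:ℝ) ^ 2 * ‖O‖ ≤ 300 * η) ∧ (n:ℝ) * ‖O1‖ ≤ 300 ∧ η ^ 2 * ‖O2‖ ≤ 300 * η ∧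
      ‖O‖ ≤ 300 ∧ ‖O1‖ ≤ 300 := by
    intro n
    rcases Nat.lt_or_ge n 2 with h | h
    · interval_cases n
      · refine ⟨0, 0, 0, by simp, by simp, ?_, ?_, ?_, ?_, ?_, by simp, ?_, ?_, ?_, ?_, ?_⟩
        · intro f X; exact hasDerivAt_const X (0:ℝ)
        · intro f X; exact hasDerivAt_const X (0:ℝ)
        · intro f X; rfl
        · intro f X; exact neg_zero.symm
        · intro f X; rfl
        · intro _; simp; exact hη.le
        · simp
        · simp; exact hη.le
        · simp
        · simp
      · refine ⟨κ.K, κ.K1, κ.K2, by simp, by simp, κ.d1, κ.d2, κ.e0, κ.e1, κ.e2, by simp,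
          by simp, by simpa using κ.bK1, ?_, κ.bK, κ.bK1⟩
        have := κ.bK2
        have h0 := norm_nonneg κ.K2
        nlinarith
    · obtain ⟨O, O1, O2, d1, d2, e0, e1, e2, ode, b0, b1, b2⟩ := high_mode η hη hη1 n h
      have hn' : (2:ℝ) ≤ n := by exact_mod_cast h
      refine ⟨O, O1, O2, by omega, by omega, d1, d2, e0, e1, e2, fun _ => ode, fun _ => b0,
        b1, b2, ?_, ?_⟩
      · have h0 := norm_nonneg O
        have : (1:ℝ) ≤ (n:ℝ) ^ 2 := by nlinarith
        nlinarith
      · have h0 := norm_nonneg O1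
        nlinarith
  choose O O1 O2 h1 h0 d1 d2 e0 e1 e2 ode b0 b1 b2 bb0 bb1 using hall
  exact ⟨⟨O, O1, O2, (h1 1 rfl).1, (h1 1 rfl).2.1, (h1 1 rfl).2.2, (h0 0 rfl).1, (h0 0 rfl).2,
    d1, d2, e0, e1, e2, ode, b0, b1, b2, bb0, bb1⟩⟩


theorem ev_sg (x y : ℝ) (k : ℤ) (f : CF) : ev x y (sg k f) = (f x : ℂ) * ek k y := by
  rw [ev, lift_sg, evk_apply]

theorem ev_dl (x y : ℝ) : ev x y (dl ((1/2 : ℝ) • s0)) = (((cosh x)⁻¹ * cos y : ℝ) : ℂ) := by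
  have h := ek_cos 1 y
  rw [dl, map_add, ev_sg, ev_sg, ← mul_add, h, CF.smul_apply, s0_apply]
  push_cast
  ring_nf

theorem re_deriv {f : ℝ → ℂ} {f' : ℂ} {x : ℝ} (h : HasDerivAt f f' x) :
    HasDerivAt (fun t => (f t).re) f'.re x := by
  have := (Complex.reCLM.hasFDerivAt (x := f x)).comp_hasDerivAt x h
  exact this

theorem sol_mk {η C : ℝ} (v p q r s t : ℝ → ℝ → ℂ)
    (dx : ∀ x y, HasDerivAt (fun a => v a y) (p x y) x)
    (dy : ∀ x y, HasDerivAt (fun a => v x a) (q x y) y)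
    (dxx : ∀ x y, HasDerivAt (fun a => p a y) (r x y) x)
    (dxy : ∀ x y, HasDerivAt (fun a => p x a) (s x y) y)
    (dyx : ∀ x y, HasDerivAt (fun a => q a y) (s x y) x)
    (dyy : ∀ x y, HasDerivAt (fun a => q x a) (t x y) y)
    (cr : Continuous fun z : ℝ × ℝ => r z.1 z.2)
    (cs : Continuous fun z : ℝ × ℝ => s z.1 z.2)
    (ct : Continuous fun z : ℝ × ℝ => t z.1 z.2) (K : ℝ)
    (bv : ∀ x y, ‖v x y‖ ≤ K) (bp : ∀ x y, ‖p x y‖ ≤ K) (bq : ∀ x y, ‖q x y‖ ≤ K)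
    (br : ∀ x y, ‖r x y‖ ≤ K) (bs : ∀ x y, ‖s x y‖ ≤ K) (bt : ∀ x y, ‖t x y‖ ≤ K)
    (pde : ∀ x y, (r x y).re + (t x y).re + (v x y).re - η ^ 2 * (v x y).re =
      8 / 3 * η ^ 2 * (3 * (p x y).re ^ 2 * (r x y).re + (q x y).re ^ 2 * (r x y).re +
        4 * (p x y).re * (q x y).re * (s x y).re + (p x y).re ^ 2 * (t x y).re +
        3 * (q x y).re ^ 2 * (t x y).re))
    (bl : ∀ x, (v x (-(π / 2))).re = 0) (bdr : ∀ x, (v x (π / 2)).re = 0)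
    (cl : ∀ x y, |(v x y).re - (cosh (η * x))⁻¹ * cos y| ≤ C * η)
    (dec : ∀ δ > 0, ∃ X : ℝ, ∀ x, X ≤ |x| → ∀ y, |(v x y).re| ≤ δ) : Nonempty (Sol η C) :=
  ⟨{ v := fun z => (v z.1 z.2).re
     vx := fun z => (p z.1 z.2).re
     vy := fun z => (q z.1 z.2).re
     vxx := fun z => (r z.1 z.2).re
     vxy := fun z => (s z.1 z.2).re
     vyy := fun z => (t z.1 z.2).re
     dx := fun x y => re_deriv (dx x y)
     dy := fun x y => re_deriv (dy x y)
     dxx := fun x y => re_deriv (dxx x y)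
     dxy := fun x y => re_deriv (dxy x y)
     dyx := fun x y => re_deriv (dyx x y)
     dyy := fun x y => re_deriv (dyy x y)
     cxx := Complex.continuous_re.comp cr
     cxy := Complex.continuous_re.comp cs
     cyy := Complex.continuous_re.comp ct
     K := K
     b := fun z => (Complex.abs_re_le_norm _).trans (bv z.1 z.2)
     bx := fun z => (Complex.abs_re_le_norm _).trans (bp z.1 z.2)
     by' := fun z => (Complex.abs_re_le_norm _).trans (bq z.1 z.2)
     bxx := fun z => (Complex.abs_re_le_norm _).trans (br z.1 z.2)
     bxy := fun z => (Complex.abs_re_le_norm _).trans (bs z.1 z.2)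
     byy := fun z => (Complex.abs_re_le_norm _).trans (bt z.1 z.2)
     pde := fun z => pde z.1 z.2
     bdl := bl
     bdr := bdr
     close := cl
     decay := dec }⟩

theorem sol_of_E {η C : ℝ} (hη : η ≠ 0) (V P Q R S T : ES)
    (hP : ∀ k x, HasDerivAt (fun x => V k (η * x)) (P k (η * x)) x)
    (hR : ∀ k x, HasDerivAt (fun x => P k (η * x)) (R k (η * x)) x)
    (hSd : ∀ k x, HasDerivAt (fun x => Q k (η * x)) (S k (η * x)) x)
    (hQ : ∀ k x, Q k x = (k : ℝ) * V k x) (hS : ∀ k x, S k x = (k : ℝ) * P k x)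
    (hT : ∀ k x, T k x = - ((k : ℝ) * Q k x))
    (JV : Jk V = V) (JP : Jk P = P) (JR : Jk R = R) (PV : Pk V = -V)
    (eq : R + T + V - η ^ 2 • V = (8 / 3 * η ^ 2) • NN P Q R S T)
    (hC : ‖V - dl ((1/2 : ℝ) • s0)‖ ≤ C * η) : Nonempty (Sol η C) := by
  have even_of : ∀ {a : ES}, Jk a = a → ∀ k x, a (-k) x = a k x := by
    intro a h k x
    rw [← Jk_apply, h]
  have JQ : Jk Q = -Q := by
    refine ES_coord_ext fun k x => ?_
    rw [Jk_apply, ES_neg_apply, CF.neg_apply, hQ, hQ, even_of JV]; push_cast; ring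
  have JS : Jk S = -S := by
    refine ES_coord_ext fun k x => ?_
    rw [Jk_apply, ES_neg_apply, CF.neg_apply, hS, hS, even_of JP]; push_cast; ring
  have JT : Jk T = T := by
    refine ES_coord_ext fun k x => ?_
    rw [Jk_apply, hT, hT, hQ, hQ, even_of JV]; push_cast; ring
  have dT : ∀ x y, HasDerivAt (fun y => Complex.I * ev x y Q) (ev x y T) y := by
    intro x y
    have h := (ev_dy (a := Q) (b := -T) (fun k x => by
      rw [ES_neg_apply, CF.neg_apply, hT]; ring) x y).const_mul Complex.I
    refine h.congr_deriv ?_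
    rw [map_neg]
    linear_combination (- ev x y T) * Complex.I_mul_I
  have rele : ∀ (z : ℂ) (a : ES) (x y : ℝ), ‖z‖ = ‖ev x y a‖ → |z.re| ≤ ‖a‖ := by
    intro z a x y h
    exact (Complex.abs_re_le_norm z).trans (h.le.trans (ev_norm_le x y a))
  have nI : ∀ z : ℂ, ‖Complex.I * z‖ = ‖z‖ := by
    intro z; rw [norm_mul, Complex.norm_I, one_mul]
  have cI : ∀ a : ES, Continuous (fun p : ℝ × ℝ => Complex.I * ev (η * p.1) p.2 a) :=
    fun a => continuous_const.mul (ev_cont η a)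
  have hpde : ∀ p : ℝ × ℝ, (ev (η * p.1) p.2 R).re + (ev (η * p.1) p.2 T).re + (ev (η * p.1) p.2 V).re - η ^ 2 * (ev (η * p.1) p.2 V).re =
    8 / 3 * η ^ 2 * (3 * (ev (η * p.1) p.2 P).re ^ 2 * (ev (η * p.1) p.2 R).re +
    (Complex.I * ev (η * p.1) p.2 Q).re ^ 2 * (ev (η * p.1) p.2 R).re + 4 * (ev (η * p.1) p.2 P).re * (Complex.I * ev (η * p.1) p.2 Q).re * (Complex.I * ev (η * p.1) p.2 S).re +
    (ev (η * p.1) p.2 P).re ^ 2 * (ev (η * p.1) p.2 T).re + 3 * (Complex.I * ev (η * p.1) p.2 Q).re ^ 2 * (ev (η * p.1) p.2 T).re) := by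
    intro p
    have h := congrArg (ev (η * p.1) p.2) eq
    simp only [NN, tri, map_add, map_sub, map_smul, ev_cv] at h
    have rV := ev_real JV (η * p.1) p.2
    have rP := ev_real JP (η * p.1) p.2
    have rQ := ev_imag JQ (η * p.1) p.2
    have rR := ev_real JR (η * p.1) p.2
    have rS := ev_imag JS (η * p.1) p.2
    have rT := ev_real JT (η * p.1) p.2
    have hI := Complex.I_mul_I
    have rQ' : ev (η * p.1) p.2 Q = - Complex.I * ((Complex.I * ev (η * p.1) p.2 Q).re : ℝ) := by
      rw [rQ]; linear_combination (ev (η * p.1) p.2 Q) * hI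
    have rS' : ev (η * p.1) p.2 S = - Complex.I * ((Complex.I * ev (η * p.1) p.2 S).re : ℝ) := by
      rw [rS]; linear_combination (ev (η * p.1) p.2 S) * hI
    rw [← rV, ← rP, ← rR, ← rT, rQ', rS'] at h
    simp only [Complex.real_smul] at h
    apply Complex.ofReal_injective
    generalize (ev (η * p.1) p.2 V).re = v at *
    generalize (ev (η * p.1) p.2 P).re = vx at *
    generalize (ev (η * p.1) p.2 R).re = vxx at *
    generalize (ev (η * p.1) p.2 T).re = vyy at *
    generalize (Complex.I * ev (η * p.1) p.2 Q).re = vy at *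
    generalize (Complex.I * ev (η * p.1) p.2 S).re = vxy at *
    push_cast at h ⊢
    linear_combination h + 8 / 3 * (η : ℂ) ^ 2 * (- vy ^ 2 * vxx - 4 * vx * vy * vxy
      - 3 * vy ^ 2 * vyy) * hI
  have hbl : ∀ x, (ev (η * x) (-(π / 2)) V).re = 0 := by
    intro x
    rw [ev_bdy JV PV _ (fun k hk => ek_nhalf hk)]; rfl
  have hbr : ∀ x, (ev (η * x) (π / 2) V).re = 0 := by
    intro x
    rw [ev_bdy JV PV _ (fun k hk => ek_half hk)]; rfl
  have hcl : ∀ x y, |(ev (η * x) y V).re - (cosh (η * x))⁻¹ * cos y| ≤ C * η := by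
    intro x y
    have h1 : (ev (η * x) y V).re - (cosh (η * x))⁻¹ * cos y =
        (ev (η * x) y (V - dl ((1/2 : ℝ) • s0))).re := by
      rw [map_sub, ev_dl, Complex.sub_re, Complex.ofReal_re]
    rw [h1]
    exact (rele _ _ _ _ rfl).trans hC
  have hdec : ∀ δ > 0, ∃ X : ℝ, ∀ x, X ≤ |x| → ∀ y, |(ev (η * x) y V).re| ≤ δ := by
    intro δ hδ
    obtain ⟨X, hX⟩ := ev_decay V δ hδ
    refine ⟨X / |η|, fun x hx y => ?_⟩
    refine (Complex.abs_re_le_norm _).trans (hX _ ?_ y)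
    rw [div_le_iff₀ (abs_pos.2 hη)] at hx
    rw [abs_mul]; linarith
  obtain ⟨KK, k1, k2, k3, k4, k5, k6⟩ : ∃ KK : ℝ, ‖V‖ ≤ KK ∧ ‖P‖ ≤ KK ∧ ‖Q‖ ≤ KK ∧ ‖R‖ ≤ KK ∧
      ‖S‖ ≤ KK ∧ ‖T‖ ≤ KK := by
    refine ⟨‖V‖ + ‖P‖ + ‖Q‖ + ‖R‖ + ‖S‖ + ‖T‖, ?_⟩
    have n1 := norm_nonneg V
    have n2 := norm_nonneg P
    have n3 := norm_nonneg Q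
    have n4 := norm_nonneg R
    have n5 := norm_nonneg S
    have n6 := norm_nonneg T
    refine ⟨?_, ?_, ?_, ?_, ?_, ?_⟩ <;> linarith
  exact sol_mk (fun x y => ev (η * x) y V) (fun x y => ev (η * x) y P) (fun x y => Complex.I * ev (η * x) y Q)
    (fun x y => ev (η * x) y R) (fun x y => Complex.I * ev (η * x) y S) (fun x y => ev (η * x) y T)
    (fun x y => ev_dx hP x y) (fun x y => ev_dy hQ (η * x) y) (fun x y => ev_dx hR x y)
    (fun x y => ev_dy hS (η * x) y) (fun x y => (ev_dx hSd x y).const_mul Complex.I)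
    (fun x y => dT (η * x) y) (ev_cont η R) (cI S) (ev_cont η T) KK
    (fun x y => (ev_norm_le (η * x) y V).trans k1)
    (fun x y => (ev_norm_le (η * x) y P).trans k2)
    (fun x y => (nI (ev (η * x) y Q)).le.trans ((ev_norm_le (η * x) y Q).trans k3))
    (fun x y => (ev_norm_le (η * x) y R).trans k4)
    (fun x y => (nI (ev (η * x) y S)).le.trans ((ev_norm_le (η * x) y S).trans k5))
    (fun x y => (ev_norm_le (η * x) y T).trans k6)
    (fun x y => hpde (x, y)) hbl hbr hcl hdec


theorem ex_diag (T : ℤ → CF →L[ℝ] CF) (C : ℝ) (hC : ∀ k, ‖T k‖ ≤ C) :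
    ∃ A : LOp, ‖A‖ ≤ C ∧ ∀ h k, A h k = T k (h k) :=
  ⟨diag T C hC, diag_norm T C hC, fun h k => diag_apply T C hC h k⟩

theorem NN_R {P Q R S T : ES} (hP : Rk P = -P) (hQ : Rk Q = Q) (hR : Rk R = R) (hS : Rk S = -S)
    (hT : Rk T = T) : Rk (NN P Q R S T) = NN P Q R S T := by
  simp only [NN, tri, map_add, map_sub, map_smul, Rk_cv, hP, hQ, hR, hS, hT, map_neg, neg_apply,
    neg_neg]

theorem NN_J {P Q R S T : ES} (hP : Jk P = P) (hQ : Jk Q = -Q) (hR : Jk R = R) (hS : Jk S = -S)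
    (hT : Jk T = T) : Jk (NN P Q R S T) = NN P Q R S T := by
  simp only [NN, tri, map_add, map_sub, map_smul, Jk_cv, hP, hQ, hR, hS, hT, map_neg, neg_apply,
    neg_neg]

theorem NN_P {P Q R S T : ES} (hP : Pk P = -P) (hQ : Pk Q = -Q) (hR : Pk R = -R) (hS : Pk S = -S)
    (hT : Pk T = -T) : Pk (NN P Q R S T) = - NN P Q R S T := by
  simp only [NN, tri, map_add, map_sub, map_smul, Pk_cv, hP, hQ, hR, hS, hT, map_neg, neg_apply,
    neg_neg]
  module

theorem tri_R {a b c : ES} (ha : Rk a = a) (hb : Rk b = b) (hc : Rk c = c) :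
    Rk (tri a b c) = tri a b c := by
  simp only [tri, Rk_cv, ha, hb, hc]

theorem tri_J {a b c : ES} (ha : Jk a = -a) (hb : Jk b = -b) (hc : Jk c = c) :
    Jk (tri a b c) = tri a b c := by
  simp only [tri, Jk_cv, ha, hb, hc, map_neg, neg_apply, neg_neg]

theorem tri_P {a b c : ES} (ha : Pk a = -a) (hb : Pk b = -b) (hc : Pk c = -c) :
    Pk (tri a b c) = - tri a b c := by
  simp only [tri, Pk_cv, ha, hb, hc, map_neg, neg_apply, neg_neg]

theorem sgnk_one {k : ℤ} (h : k.natAbs = 1) : sgnk k = -1 := by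
  rcases Int.natAbs_eq_iff.1 h with h | h <;> subst h <;> simp [sgnk]

/-- the symmetric closed set -/
def SymS : Set ES := {h | Rk h = h ∧ Jk h = h ∧ Pk h = -h}

theorem SymS_closed : IsClosed SymS := by
  have h1 : IsClosed {h : ES | Rk h = h} := isClosed_eq Rk.continuous continuous_id
  have h2 : IsClosed {h : ES | Jk h = h} := isClosed_eq Jk.continuous continuous_id
  have h3 : IsClosed {h : ES | Pk h = -h} := isClosed_eq Pk.continuous continuous_neg
  exact h1.inter (h2.inter h3)

theorem SymS_zero : (0 : ES) ∈ SymS := by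
  refine ⟨map_zero _, map_zero _, ?_⟩
  rw [map_zero, neg_zero]

theorem SymS.even {h : ES} (hh : h ∈ SymS) (k : ℤ) : h (-k) = h k := by
  rw [← Jk_apply, hh.2.1]

theorem SymS.refl {h : ES} (hh : h ∈ SymS) (k : ℤ) : rfn (h k) = h k := by
  rw [← Rk_apply, hh.1]

theorem SymS.reflx {h : ES} (hh : h ∈ SymS) (k : ℤ) (x : ℝ) : h k (-x) = h k x := by
  rw [← rfn_apply, SymS.refl hh]

theorem SymS.par {h : ES} (hh : h ∈ SymS) (k : ℤ) : sgnk k = -1 ∨ h k = 0 := by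
  unfold sgnk
  split_ifs with he
  · right
    have h1 := congrArg (fun a : ES => a k) hh.2.2
    simp only [Pk_apply, ES_neg_apply, sgnk, if_pos he, one_smul] at h1
    refine CF.ext' fun x => ?_
    have h2 := congrArg (fun a : CF => a x) h1
    simp only [CF.neg_apply] at h2
    rw [CF.zero_apply]; linarith
  · left; rfl

theorem mem_SymS {h : ES} (h1 : ∀ k x, h k (-x) = h k x) (h2 : ∀ k x, h (-k) x = h k x)
    (h3 : ∀ k, sgnk k = -1 ∨ h k = 0) : h ∈ SymS := by
  refine ⟨ES_coord_ext fun k x => ?_, ES_coord_ext fun k x => ?_, ES_coord_ext fun k x => ?_⟩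
  · rw [Rk_apply, rfn_apply, h1]
  · rw [Jk_apply, h2]
  · rw [Pk_apply, ES_neg_apply, CF.smul_apply, CF.neg_apply]
    rcases h3 k with h | h
    · rw [h]; ring
    · rw [h, CF.zero_apply]; ring

structure Six (η : ℝ) (κ : KD) (F : Fam η κ) (h V P Q R S T : ES) : Prop where
  hV : ∀ k x, V k x = (if k.natAbs = 1 then 1 / 2 * s0 x else 0) + F.O k.natAbs (h k) x
  hP : ∀ k x, P k x = η * ((if k.natAbs = 1 then 1 / 2 * s1 x else 0) + F.O1 k.natAbs (h k) x)
  hQ : ∀ k x, Q k x = (k : ℝ) * V k x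
  hR : ∀ k x, R k x = η ^ 2 * ((if k.natAbs = 1 then 1 / 2 * s2 x else 0) + F.O2 k.natAbs (h k) x)
  hS : ∀ k x, S k x = (k : ℝ) * P k x
  hT : ∀ k x, T k x = - ((k : ℝ) * Q k x)

theorem s0_ev (x : ℝ) : s0 (-x) = s0 x := by rw [← rfn_apply, s0_even]
theorem s1_od (x : ℝ) : s1 (-x) = - s1 x := by rw [← rfn_apply, s1_odd, CF.neg_apply]
theorem s2_ev (x : ℝ) : s2 (-x) = s2 x := by rw [← rfn_apply, s2_even]

namespace Six
variable {η : ℝ} {κ : KD} {F : Fam η κ} {h V P Q R S T : ES}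

theorem memV (w : Six η κ F h V P Q R S T) (hh : h ∈ SymS) : V ∈ SymS := by
  refine mem_SymS ?_ ?_ ?_
  · intro k x; simp only [w.hV, s0_ev, F.e0]
  · intro k x; simp only [w.hV, Int.natAbs_neg, SymS.even hh]
  · intro k
    rcases SymS.par hh k with h1 | h1
    · exact Or.inl h1
    · by_cases h2 : k.natAbs = 1
      · exact Or.inl (sgnk_one h2)
      · right
        refine CF.ext' fun x => ?_
        rw [w.hV, if_neg h2, h1, map_zero]; simp [CF.zero_apply]

theorem memR (w : Six η κ F h V P Q R S T) (hh : h ∈ SymS) : R ∈ SymS := by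
  refine mem_SymS ?_ ?_ ?_
  · intro k x; simp only [w.hR, s2_ev, F.e2]
  · intro k x; simp only [w.hR, Int.natAbs_neg, SymS.even hh]
  · intro k
    rcases SymS.par hh k with h1 | h1
    · exact Or.inl h1
    · by_cases h2 : k.natAbs = 1
      · exact Or.inl (sgnk_one h2)
      · right
        refine CF.ext' fun x => ?_
        rw [w.hR, if_neg h2, h1, map_zero]; simp [CF.zero_apply]

theorem RP (w : Six η κ F h V P Q R S T) : Rk P = -P := by
  refine ES_coord_ext fun k x => ?_
  rw [Rk_apply, rfn_apply, ES_neg_apply, CF.neg_apply, w.hP, w.hP, s1_od, F.e1]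
  split_ifs <;> ring

theorem JP (w : Six η κ F h V P Q R S T) (hh : h ∈ SymS) : Jk P = P := by
  refine ES_coord_ext fun k x => ?_
  rw [Jk_apply, w.hP, w.hP, Int.natAbs_neg, SymS.even hh]

theorem parP (w : Six η κ F h V P Q R S T) (hh : h ∈ SymS) (k : ℤ) : sgnk k = -1 ∨ P k = 0 := by
  rcases SymS.par hh k with h1 | h1
  · exact Or.inl h1
  · by_cases h2 : k.natAbs = 1
    · exact Or.inl (sgnk_one h2)
    · right
      refine CF.ext' fun x => ?_
      rw [w.hP, if_neg h2, h1, map_zero]; simp [CF.zero_apply]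

theorem Pk_of {a : ES} (h3 : ∀ k, sgnk k = -1 ∨ a k = 0) : Pk a = -a := by
  refine ES_coord_ext fun k x => ?_
  rw [Pk_apply, ES_neg_apply, CF.smul_apply, CF.neg_apply]
  rcases h3 k with h | h
  · rw [h]; ring
  · rw [h, CF.zero_apply]; ring

theorem PP (w : Six η κ F h V P Q R S T) (hh : h ∈ SymS) : Pk P = -P := Pk_of (w.parP hh)

theorem parQ (w : Six η κ F h V P Q R S T) (hh : h ∈ SymS) (k : ℤ) : sgnk k = -1 ∨ Q k = 0 := by
  rcases SymS.par (w.memV hh) k with h1 | h1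
  · exact Or.inl h1
  · right
    refine CF.ext' fun x => ?_
    rw [w.hQ, h1, CF.zero_apply, mul_zero]

theorem PQ (w : Six η κ F h V P Q R S T) (hh : h ∈ SymS) : Pk Q = -Q := Pk_of (w.parQ hh)

theorem PS (w : Six η κ F h V P Q R S T) (hh : h ∈ SymS) : Pk S = -S := by
  refine Pk_of fun k => ?_
  rcases w.parP hh k with h1 | h1
  · exact Or.inl h1
  · right
    refine CF.ext' fun x => ?_
    rw [w.hS, h1, CF.zero_apply, mul_zero]

theorem PT (w : Six η κ F h V P Q R S T) (hh : h ∈ SymS) : Pk T = -T := by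
  refine Pk_of fun k => ?_
  rcases w.parQ hh k with h1 | h1
  · exact Or.inl h1
  · right
    refine CF.ext' fun x => ?_
    rw [w.hT, h1, CF.zero_apply, mul_zero, neg_zero]

theorem RQ (w : Six η κ F h V P Q R S T) (hh : h ∈ SymS) : Rk Q = Q := by
  refine ES_coord_ext fun k x => ?_
  rw [Rk_apply, rfn_apply, w.hQ, w.hQ, SymS.reflx (w.memV hh)]

theorem RS (w : Six η κ F h V P Q R S T) : Rk S = -S := by
  refine ES_coord_ext fun k x => ?_
  have h1 := congrArg (fun a : ES => a k x) w.RP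
  simp only [Rk_apply, rfn_apply, ES_neg_apply, CF.neg_apply] at h1
  rw [Rk_apply, rfn_apply, ES_neg_apply, CF.neg_apply, w.hS, w.hS, h1]; ring

theorem RT (w : Six η κ F h V P Q R S T) (hh : h ∈ SymS) : Rk T = T := by
  refine ES_coord_ext fun k x => ?_
  rw [Rk_apply, rfn_apply, w.hT, w.hT, w.hQ, w.hQ, SymS.reflx (w.memV hh)]

theorem JQ (w : Six η κ F h V P Q R S T) (hh : h ∈ SymS) : Jk Q = -Q := by
  refine ES_coord_ext fun k x => ?_
  rw [Jk_apply, ES_neg_apply, CF.neg_apply, w.hQ, w.hQ, SymS.even (w.memV hh)]; push_cast; ring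

theorem JS (w : Six η κ F h V P Q R S T) (hh : h ∈ SymS) : Jk S = -S := by
  refine ES_coord_ext fun k x => ?_
  have h1 := congrArg (fun a : ES => a k x) (w.JP hh)
  simp only [Jk_apply] at h1
  rw [Jk_apply, ES_neg_apply, CF.neg_apply, w.hS, w.hS, h1]; push_cast; ring

theorem JT (w : Six η κ F h V P Q R S T) (hh : h ∈ SymS) : Jk T = T := by
  refine ES_coord_ext fun k x => ?_
  rw [Jk_apply, w.hT, w.hT, w.hQ, w.hQ, SymS.even (w.memV hh)]; push_cast; ring

theorem memN (w : Six η κ F h V P Q R S T) (hh : h ∈ SymS) : NN P Q R S T ∈ SymS := by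
  have hR := w.memR hh
  exact ⟨NN_R w.RP (w.RQ hh) hR.1 w.RS (w.RT hh), NN_J (w.JP hh) (w.JQ hh) hR.2.1 (w.JS hh) (w.JT hh),
    NN_P (w.PP hh) (w.PQ hh) hR.2.2 (w.PS hh) (w.PT hh)⟩

theorem sol (w : Six η κ F h V P Q R S T) (hh : h ∈ SymS) (hη : η ≠ 0) {C : ℝ}
    (n1 : ∀ k : ℤ, k.natAbs = 1 → ∀ x, h k x = 8 / 3 * NN P Q R S T k x + s0 x ^ 3 +
      6 * s0 x ^ 2 * κ.K (h k) x)
    (n2 : ∀ k : ℤ, k.natAbs ≠ 1 → ∀ x, h k x = 8 / 3 * (η * NN P Q R S T k x))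
    (hC : ‖V - dl ((1/2 : ℝ) • s0)‖ ≤ C * η) : Nonempty (Sol η C) := by
  have hlin : ∀ x, HasDerivAt (fun x : ℝ => η * x) η x := fun x => by
    simpa using (hasDerivAt_id x).const_mul η
  have dP : ∀ k x, HasDerivAt (fun x => V k (η * x)) (P k (η * x)) x := by
    intro k x
    simp only [w.hV, w.hP]
    have h1 := (F.d1 k.natAbs (h k) (η * x)).comp x (hlin x)
    have h2 := ((d_s0 (η * x)).comp x (hlin x)).const_mul (1 / 2 : ℝ)
    split_ifs with hk
    · exact (h2.add h1).congr_deriv (by ring)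
    · exact (h1.const_add 0).congr_deriv (by ring)
  have dR : ∀ k x, HasDerivAt (fun x => P k (η * x)) (R k (η * x)) x := by
    intro k x
    simp only [w.hP, w.hR]
    have h1 := (F.d2 k.natAbs (h k) (η * x)).comp x (hlin x)
    have h2 := ((d_s1 (η * x)).comp x (hlin x)).const_mul (1 / 2 : ℝ)
    split_ifs with hk
    · exact ((h2.add h1).const_mul η).congr_deriv (by ring)
    · exact ((h1.const_add 0).const_mul η).congr_deriv (by ring)
  refine sol_of_E hη V P Q R S T dP dR ?_ w.hQ w.hS w.hT (w.memV hh).2.1 (w.JP hh) (w.memR hh).2.1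
    (w.memV hh).2.2 ?_ hC
  · intro k x
    simp only [w.hQ, w.hS]
    exact (dP k x).const_mul _
  · refine ES_coord_ext fun k x => ?_
    have hN := w.memN hh
    simp only [ES_sub_apply, ES_add_apply, ES_smul_apply, CF.sub_apply, CF.add_apply, CF.smul_apply]
    rw [w.hT, w.hQ]
    have hk2 : (k : ℝ) ^ 2 = ((k.natAbs : ℕ) : ℝ) ^ 2 := by
      rw [Nat.cast_natAbs]; push_cast; rw [sq_abs]
    by_cases hk : k.natAbs = 1
    · have h1 := n1 k hk x
      have h2 := κ.ode (h k) (SymS.refl hh k) x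
      rw [hk, Nat.cast_one, one_pow] at hk2
      rw [w.hR, w.hV, if_pos hk, if_pos hk, hk, F.one0, F.one2, h2, s2_apply]
      generalize NN P Q R S T k x = N at *
      generalize κ.K (h k) x = K at *
      linear_combination η ^ 2 * h1 - (1 / 2 * s0 x + K) * hk2
    · by_cases hk0 : k.natAbs = 0
      · have hk3 : k = 0 := Int.natAbs_eq_zero.1 hk0
        rw [w.hR, w.hV, if_neg hk, if_neg hk, hk0, F.zero0, F.zero2]
        have : NN P Q R S T k = 0 := by
          rcases SymS.par hN k with h1 | h1
          · subst hk3; simp [sgnk] at h1; norm_num at h1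
          · exact h1
        rw [this]
        simp [CF.zero_apply]
      · have h1 := n2 k hk x
        have h2 := F.ode k.natAbs (by omega) (h k) (SymS.refl hh k) x
        rw [w.hR, w.hV, if_neg hk, if_neg hk]
        rw [h1] at h2
        linear_combination h2 - (F.O k.natAbs (h k) x) * hk2
end Six


theorem ite_bound {p : Prop} [Decidable p] {a b : CF →L[ℝ] CF} {C : ℝ} (ha : p → ‖a‖ ≤ C)
    (hb : ¬ p → ‖b‖ ≤ C) : ‖if p then a else b‖ ≤ C := by
  split_ifs with h
  · exact ha h
  · exact hb h

theorem natAbs_one_abs {k : ℤ} (h : k.natAbs = 1) : ‖(k : ℝ)‖ = 1 := by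
  rcases Int.natAbs_eq_iff.1 h with h | h <;> subst h <;> simp

theorem normk (k : ℤ) : ‖(k : ℝ)‖ = (k.natAbs : ℝ) := by
  rw [Real.norm_eq_abs, Nat.cast_natAbs]; push_cast; rfl

/-- all the operators of the fixed point problem -/
structure Ops (η : ℝ) (κ : KD) (F : Fam η κ) (Q0 T0 Pi AP AQ AR AS AT c : LOp) : Prop where
  hQ0 : ∀ h k, Q0 h k = (if k.natAbs = 1 then (k : ℝ) • κ.K else 0) (h k)
  hT0 : ∀ h k, T0 h k = (if k.natAbs = 1 then - κ.K else 0) (h k)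
  hPi : ∀ h k, Pi h k = (if k.natAbs = 1 then ContinuousLinearMap.id ℝ CF else 0) (h k)
  hAP : ∀ h k, AP h k = (η • F.O1 k.natAbs) (h k)
  hAQ : ∀ h k, AQ h k = (if k.natAbs = 1 then 0 else (k : ℝ) • F.O k.natAbs) (h k)
  hAR : ∀ h k, AR h k = (η ^ 2 • F.O2 k.natAbs) (h k)
  hAS : ∀ h k, AS h k = ((k * η : ℝ) • F.O1 k.natAbs) (h k)
  hAT : ∀ h k, AT h k = (if k.natAbs = 1 then 0 else (-(k : ℝ) ^ 2) • F.O k.natAbs) (h k)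
  hc : ∀ h k, c h k = (if k.natAbs = 1 then 0 else η • ContinuousLinearMap.id ℝ CF) (h k)

theorem Ops.six {η : ℝ} {κ : KD} {F : Fam η κ} {Q0 T0 Pi AP AQ AR AS AT c : LOp}
    (o : Ops η κ F Q0 T0 Pi AP AQ AR AS AT c) {AV : LOp}
    (hAV : ∀ h k, AV h k = F.O k.natAbs (h k)) (h : ES) :
    Six η κ F h (dl ((1/2 : ℝ) • s0) + AV h) (η • dl ((1/2 : ℝ) • s1) + AP h)
      (dm ((1/2 : ℝ) • s0) + Q0 h + AQ h) (η ^ 2 • dl ((1/2 : ℝ) • s2) + AR h)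
      (η • dm ((1/2 : ℝ) • s1) + AS h) (- dl ((1/2 : ℝ) • s0) + T0 h + AT h) := by
  have k2 : ∀ k : ℤ, k.natAbs = 1 → (k : ℝ) * k = 1 := by
    intro k hk
    rcases Int.natAbs_eq_iff.1 hk with h | h <;> subst h <;> simp
  constructor
  · intro k x
    simp only [ES_add_apply, dl_apply, hAV, CF.add_apply]
    split_ifs <;> simp [CF.smul_apply, CF.zero_apply]
  · intro k x
    simp only [ES_add_apply, ES_smul_apply, dl_apply, o.hAP, CF.add_apply, CF.smul_apply, smul_apply]
    split_ifs <;> simp [CF.smul_apply, CF.zero_apply] <;> ring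
  · intro k x
    simp only [ES_add_apply, dl_apply, dm_apply, hAV, o.hQ0, o.hAQ, CF.add_apply]
    split_ifs with hk
    · rw [hk, F.one0]
      simp only [smul_apply, CF.smul_apply, zero_apply, CF.zero_apply]; ring
    · simp only [smul_apply, CF.smul_apply, zero_apply, CF.zero_apply]; ring
  · intro k x
    simp only [ES_add_apply, ES_smul_apply, dl_apply, o.hAR, CF.add_apply, CF.smul_apply, smul_apply]
    split_ifs <;> simp [CF.smul_apply, CF.zero_apply] <;> ring
  · intro k x
    simp only [ES_add_apply, ES_smul_apply, dl_apply, dm_apply, o.hAP, o.hAS, CF.add_apply,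
      CF.smul_apply, smul_apply]
    split_ifs <;> simp [CF.smul_apply, CF.zero_apply] <;> ring
  · intro k x
    simp only [ES_add_apply, ES_neg_apply, dl_apply, dm_apply, o.hT0, o.hAT, o.hQ0, o.hAQ,
      CF.add_apply, CF.neg_apply]
    split_ifs with hk
    · simp only [smul_apply, CF.smul_apply, zero_apply, CF.zero_apply, neg_apply, CF.neg_apply]
      linear_combination (s0 x / 2 + κ.K (h k) x) * k2 k hk
    · simp only [smul_apply, CF.smul_apply, zero_apply, CF.zero_apply]; ring

theorem PiR {Pi : LOp} {a : ℝ} {p : ℤ → Prop} [DecidablePred p] {ha : ES} (hs : ha ∈ SymS)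
    (hp : ∀ k, p (-k) ↔ p k)
    (h : ∀ h k, Pi h k = (if p k then a • ContinuousLinearMap.id ℝ CF else 0) (h k)) :
    Pi ha ∈ SymS := by
  have h' : ∀ k x, Pi ha k x = if p k then a * ha k x else 0 := by
    intro k x
    rw [h]
    split_ifs <;> rfl
  refine mem_SymS ?_ ?_ ?_
  · intro k x; rw [h', h', SymS.reflx hs]
  · intro k x; simp only [h', hp, SymS.even hs]
  · intro k
    rcases SymS.par hs k with h1 | h1
    · exact Or.inl h1
    · right
      refine CF.ext' fun x => ?_
      rw [h', h1]; simp [CF.zero_apply]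

theorem SymS_add {a b : ES} (ha : a ∈ SymS) (hb : b ∈ SymS) : a + b ∈ SymS := by
  refine ⟨?_, ?_, ?_⟩
  · rw [map_add, ha.1, hb.1]
  · rw [map_add, ha.2.1, hb.2.1]
  · rw [map_add, ha.2.2, hb.2.2]; abel

theorem SymS_smul {a : ES} (r : ℝ) (ha : a ∈ SymS) : r • a ∈ SymS := by
  refine ⟨?_, ?_, ?_⟩
  · rw [map_smul, ha.1]
  · rw [map_smul, ha.2.1]
  · rw [map_smul, ha.2.2, smul_neg]

theorem SymS_tri {a b c : CF} (ha : rfn a = a) (hb : rfn b = b) (hc : rfn c = c) :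
    tri (dm a) (dm b) (dl c) ∈ SymS := by
  have hd : ∀ {f : CF}, rfn f = f → Rk (dm f) = dm f ∧ Jk (dm f) = - dm f ∧ Pk (dm f) = - dm f := by
    intro f hf
    refine ⟨ES_coord_ext fun k x => ?_, ES_coord_ext fun k x => ?_, Six.Pk_of fun k => ?_⟩
    · rw [Rk_apply, rfn_apply, dm_apply]
      have : f (-x) = f x := by rw [← rfn_apply, hf]
      split_ifs
      · rw [CF.smul_apply, CF.smul_apply, this]
      · rfl
    · rw [Jk_apply, ES_neg_apply, dm_apply, dm_apply, Int.natAbs_neg]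
      split_ifs
      · rw [CF.neg_apply, CF.smul_apply, CF.smul_apply]; push_cast; ring
      · simp [CF.zero_apply]
    · rw [dm_apply]
      by_cases hk : k.natAbs = 1
      · exact Or.inl (sgnk_one hk)
      · exact Or.inr (if_neg hk)
  have he : dl c ∈ SymS := by
    refine mem_SymS ?_ ?_ ?_
    · intro k x
      have : c (-x) = c x := by rw [← rfn_apply, hc]
      rw [dl_apply]
      split_ifs
      · exact this
      · rfl
    · intro k x; rw [dl_apply, dl_apply, Int.natAbs_neg]
    · intro k
      rw [dl_apply]
      by_cases hk : k.natAbs = 1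
      · exact Or.inl (sgnk_one hk)
      · exact Or.inr (if_neg hk)
  exact ⟨tri_R (hd ha).1 (hd hb).1 he.1, tri_J (hd ha).2.1 (hd hb).2.1 he.2.1,
    tri_P (hd ha).2.2 (hd hb).2.2 he.2.2⟩

/-- the second term -/
theorem ZZ {κ : KD} {Q0 T0 : LOp} 
    (hQ0 : ∀ h k, Q0 h k = (if k.natAbs = 1 then (k : ℝ) • κ.K else 0) (h k))
    (hT0 : ∀ h k, T0 h k = (if k.natAbs = 1 then - κ.K else 0) (h k))
    {h : ES} (hh : h ∈ SymS) :
    (tri (dm ((1/2 : ℝ) • s0)) (dm ((1/2 : ℝ) • s0)) (- dl ((1/2 : ℝ) • s0))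
      + tri (Q0 h) (dm ((1/2 : ℝ) • s0)) (- dl ((1/2 : ℝ) • s0))
      + tri (dm ((1/2 : ℝ) • s0)) (Q0 h) (- dl ((1/2 : ℝ) • s0))
      + tri (dm ((1/2 : ℝ) • s0)) (dm ((1/2 : ℝ) • s0)) (T0 h) : ES) ∈ SymS ∧
    ∀ k : ℤ, k.natAbs = 1 → ∀ x, 
    (tri (dm ((1/2 : ℝ) • s0)) (dm ((1/2 : ℝ) • s0)) (- dl ((1/2 : ℝ) • s0))
      + tri (Q0 h) (dm ((1/2 : ℝ) • s0)) (- dl ((1/2 : ℝ) • s0))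
      + tri (dm ((1/2 : ℝ) • s0)) (Q0 h) (- dl ((1/2 : ℝ) • s0))
      + tri (dm ((1/2 : ℝ) • s0)) (dm ((1/2 : ℝ) • s0)) (T0 h) : ES) k x =
      1 / 8 * (s0 x ^ 3 + 6 * s0 x ^ 2 * κ.K (h k) x) := by
  have hk1 : ∀ k : ℤ, k.natAbs = 1 → h k = h 1 := by
    intro k hk
    rcases Int.natAbs_eq_iff.1 hk with h1 | h1 <;> simp only [Nat.cast_one] at h1 <;> subst h1
    · rfl
    · exact SymS.even hh 1
  have eQ : Q0 h = dm (κ.K (h 1)) := by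
    refine ES_coord_ext fun k x => ?_
    rw [hQ0, dm_apply]
    split_ifs with hk
    · rw [hk1 k hk]; rfl
    · rfl
  have eT : T0 h = - dl (κ.K (h 1)) := by
    refine ES_coord_ext fun k x => ?_
    rw [hT0, ES_neg_apply, dl_apply]
    split_ifs with hk
    · rw [hk1 k hk]; rfl
    · simp [CF.zero_apply, CF.neg_apply]
  have e1 : rfn ((1/2 : ℝ) • s0) = (1/2 : ℝ) • s0 := by rw [map_smul, s0_even]
  have e2 : rfn (κ.K (h 1)) = κ.K (h 1) := CF.ext' fun x => by rw [rfn_apply, κ.e0]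
  rw [eQ, eT]
  simp only [tri_neg]
  have hneg : ∀ {a : ES}, a ∈ SymS → -a ∈ SymS := by
    intro a ha
    have := SymS_smul (-1) ha
    rwa [neg_one_smul] at this
  refine ⟨SymS_add (SymS_add (SymS_add (hneg (SymS_tri e1 e1 e1)) (hneg (SymS_tri e2 e1 e1)))
    (hneg (SymS_tri e1 e2 e1))) (hneg (SymS_tri e1 e1 e2)), fun k hk x => ?_⟩
  simp only [ES_add_apply, ES_neg_apply, tri_dm_apply _ _ _ hk, CF.add_apply, CF.neg_apply,
    CF.mul_apply, CF.smul_apply, hk1 k hk]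
  ring

theorem exists_sol : ∃ η₀ > (0:ℝ), ∃ C > (0:ℝ), ∀ η, 0 < η → η < η₀ → Nonempty (Sol η C) := by
  obtain ⟨κ⟩ := exists_KD
  obtain ⟨Q0, -, hQ0⟩ := ex_diag (fun k => if k.natAbs = 1 then (k : ℝ) • κ.K else 0) 300
    (fun k => ite_bound (fun h => by rw [norm_smul, natAbs_one_abs h, one_mul]; exact κ.bK)
      (fun _ => by rw [norm_zero]; norm_num))
  obtain ⟨T0, -, hT0⟩ := ex_diag (fun k => if k.natAbs = 1 then - κ.K else 0) 300
    (fun k => ite_bound (fun h => by rw [norm_neg]; exact κ.bK)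
      (fun _ => by rw [norm_zero]; norm_num))
  obtain ⟨Pi, -, hPi⟩ := ex_diag (fun k => if k.natAbs = 1 then ContinuousLinearMap.id ℝ CF else 0) 1
    (fun k => ite_bound (fun h => ContinuousLinearMap.norm_id_le)
      (fun _ => by rw [norm_zero]; norm_num))
  obtain ⟨δ, hδ, C, hC, hsolve⟩ := PhiN_solve (dm ((1/2 : ℝ) • s0)) (- dl ((1/2 : ℝ) • s0)) Q0 T0 Pi
  obtain ⟨M, hM0, m1, m2, m3, m4⟩ : ∃ M : ℝ, 0 < M ∧ 300 ≤ M ∧ ‖dl ((1/2 : ℝ) • s1)‖ ≤ M ∧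
      ‖dl ((1/2 : ℝ) • s2)‖ ≤ M ∧ ‖dm ((1/2 : ℝ) • s1)‖ ≤ M := by
    refine ⟨300 + ‖dl ((1/2 : ℝ) • s1)‖ + ‖dl ((1/2 : ℝ) • s2)‖ + ‖dm ((1/2 : ℝ) • s1)‖, ?_⟩
    have n1 := norm_nonneg (dl ((1/2 : ℝ) • s1))
    have n2 := norm_nonneg (dl ((1/2 : ℝ) • s2))
    have n3 := norm_nonneg (dm ((1/2 : ℝ) • s1))
    refine ⟨?_, ?_, ?_, ?_, ?_⟩ <;> linarith
  refine ⟨min 1 (δ / M), lt_min one_pos (by positivity), 300 * (C * M), by positivity, ?_⟩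
  intro η hη hηlt
  have hη1 : η ≤ 1 := (hηlt.trans_le (min_le_left _ _)).le
  have hηδ : M * η < δ := by
    have := hηlt.trans_le (min_le_right _ _)
    rw [lt_div_iff₀ hM0] at this; linarith
  have hη2 : η ^ 2 ≤ η := by nlinarith
  have hMη : 300 * η ≤ M * η := mul_le_mul_of_nonneg_right m1 hη.le
  have h300 : (0:ℝ) ≤ 300 * η := by positivity
  have nη : ‖η‖ = η := by rw [Real.norm_eq_abs, abs_of_pos hη]
  have nη2 : ‖η ^ 2‖ = η ^ 2 := by rw [norm_pow, nη]
  obtain ⟨F⟩ := exists_Fam κ η hη hη1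
  obtain ⟨AV, bAV, hAV⟩ := ex_diag (fun k => F.O k.natAbs) 300 (fun k => F.bb0 _)
  obtain ⟨AP, bAP, hAP⟩ := ex_diag (fun k => η • F.O1 k.natAbs) (300 * η) (fun k => by
    rw [norm_smul, nη]; nlinarith [F.bb1 k.natAbs])
  obtain ⟨AQ, bAQ, hAQ⟩ := ex_diag (fun k => if k.natAbs = 1 then 0 else (k : ℝ) • F.O k.natAbs)
    (300 * η) (fun k => ite_bound (fun _ => by rw [norm_zero]; exact h300) (fun hk => by
      rw [norm_smul, normk]
      refine le_trans ?_ (F.b0 k.natAbs hk)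
      refine mul_le_mul_of_nonneg_right ?_ (norm_nonneg _)
      exact_mod_cast Nat.le_self_pow (by norm_num) _))
  obtain ⟨AR, bAR, hAR⟩ := ex_diag (fun k => η ^ 2 • F.O2 k.natAbs) (300 * η) (fun k => by
    rw [norm_smul, nη2]; exact F.b2 _)
  obtain ⟨AS, bAS, hAS⟩ := ex_diag (fun k => (k * η : ℝ) • F.O1 k.natAbs) (300 * η) (fun k => by
    rw [norm_smul, norm_mul, nη, normk]; nlinarith [F.b1 k.natAbs])
  obtain ⟨AT, bAT, hAT⟩ := ex_diag
    (fun k => if k.natAbs = 1 then 0 else (-(k : ℝ) ^ 2) • F.O k.natAbs)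
    (300 * η) (fun k => ite_bound (fun _ => by rw [norm_zero]; exact h300) (fun hk => by
      rw [norm_smul, norm_neg, norm_pow, normk]
      exact F.b0 k.natAbs hk))
  obtain ⟨c, bc, hc⟩ := ex_diag
    (fun k => if k.natAbs = 1 then 0 else η • ContinuousLinearMap.id ℝ CF)
    (300 * η) (fun k => ite_bound (fun _ => by rw [norm_zero]; exact h300) (fun hk => by
      rw [norm_smul, nη]
      have : ‖ContinuousLinearMap.id ℝ CF‖ ≤ 1 := ContinuousLinearMap.norm_id_le
      nlinarith))
  have o : Ops η κ F Q0 T0 Pi AP AQ AR AS AT c := ⟨hQ0, hT0, hPi, hAP, hAQ, hAR, hAS, hAT, hc⟩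
  let l : LamT := (η • dl ((1/2 : ℝ) • s1), η ^ 2 • dl ((1/2 : ℝ) • s2), η • dm ((1/2 : ℝ) • s1),
    AP, AQ, AR, AS, AT, c)
  have hl : ‖l‖ ≤ M * η := by
    simp only [l, Prod.norm_def]
    refine max_le ?_ (max_le ?_ (max_le ?_ (max_le ?_ (max_le ?_ (max_le ?_ (max_le ?_
      (max_le ?_ ?_)))))))
    · rw [norm_smul, nη]; nlinarith
    · rw [norm_smul, nη2]; nlinarith [norm_nonneg (dl ((1/2 : ℝ) • s2))]
    · rw [norm_smul, nη]; nlinarith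
    all_goals linarith
  have hPis : ∀ a ∈ SymS, Pi a ∈ SymS := fun a ha =>
    PiR (p := fun k => k.natAbs = 1) (a := 1) ha (fun k => by rw [Int.natAbs_neg])
      (fun h k => by rw [hPi, one_smul])
  have hcs : ∀ a ∈ SymS, c a ∈ SymS := fun a ha =>
    PiR (p := fun k => ¬ k.natAbs = 1) (a := η) ha (fun k => by rw [Int.natAbs_neg])
      (fun h k => by rw [hc, ite_not])
  obtain ⟨h, hh, hfix, hn⟩ := hsolve l (hl.trans_lt hηδ) SymS SymS_closed SymS_zero (by
    intro h hh
    have w := o.six hAV h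
    have hN := w.memN hh
    have hZ := (ZZ hQ0 hT0 hh).1
    exact SymS_add (SymS_smul _ (SymS_add (hPis _ hN) (hcs _ hN))) (SymS_smul _ (hPis _ hZ)))
  have w := o.six hAV h
  have hZ := (ZZ hQ0 hT0 hh).2
  have hfk : ∀ k x, h k x = 
     (8 / 3 : ℝ) * ((Pi (NN (η • dl ((1/2 : ℝ) • s1) + AP h)
      (dm ((1/2 : ℝ) • s0) + Q0 h + AQ h) (η ^ 2 • dl ((1/2 : ℝ) • s2) + AR h)
      (η • dm ((1/2 : ℝ) • s1) + AS h) (- dl ((1/2 : ℝ) • s0) + T0 h + AT h))) k x + 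
      (c (NN (η • dl ((1/2 : ℝ) • s1) + AP h)
      (dm ((1/2 : ℝ) • s0) + Q0 h + AQ h) (η ^ 2 • dl ((1/2 : ℝ) • s2) + AR h)
      (η • dm ((1/2 : ℝ) • s1) + AS h) (- dl ((1/2 : ℝ) • s0) + T0 h + AT h))) k x) +
      8 * (Pi ((tri (dm ((1/2 : ℝ) • s0)) (dm ((1/2 : ℝ) • s0)) (- dl ((1/2 : ℝ) • s0))
      + tri (Q0 h) (dm ((1/2 : ℝ) • s0)) (- dl ((1/2 : ℝ) • s0))
      + tri (dm ((1/2 : ℝ) • s0)) (Q0 h) (- dl ((1/2 : ℝ) • s0))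
      + tri (dm ((1/2 : ℝ) • s0)) (dm ((1/2 : ℝ) • s0)) (T0 h) : ES))) k x := by
    intro k x
    exact (congrArg (fun a : ES => a k x) hfix).symm
  refine w.sol hh hη.ne' (C := 300 * (C * M)) ?_ ?_ ?_
  · intro k hk x
    have h1 := hfk k x
    rw [hPi, hPi, hc, if_pos hk, if_pos hk] at h1
    simp only [zero_apply, CF.zero_apply, ContinuousLinearMap.id_apply] at h1
    rw [hZ k hk x] at h1
    linarith
  · intro k hk x
    have h1 := hfk k x
    rw [hPi, hPi, hc, if_neg hk, if_neg hk] at h1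
    simp only [zero_apply, CF.zero_apply, ContinuousLinearMap.id_apply, smul_apply, CF.smul_apply] at h1
    linarith
  · rw [add_sub_cancel_left]
    calc ‖AV h‖ ≤ ‖AV‖ * ‖h‖ := AV.le_opNorm h
      _ ≤ 300 * (C * (M * η)) := by
        refine mul_le_mul bAV (hn.trans ?_) (norm_nonneg _) (by norm_num)
        exact mul_le_mul_of_nonneg_left hl hC.le
      _ = _ := by ring

/-- Anti-plane shear: homoclinic (pulse-type) solutions for `w₁ < 0`, `m > 0`. -/
theorem antiplane_shear_homoclinics (w₁ m : ℝ) (hw₁ : w₁ < 0) (hm : 0 < m)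
    (a₁ κ₁ : ℝ) (ha₁ : a₁ = Real.sqrt (-4 * m / (3 * w₁)))
    (hκ₁ : κ₁ = Real.sqrt m) :
    ∃ ε₀ > (0 : ℝ), ∃ C > (0 : ℝ), ∀ ε : ℝ, 0 < |ε| → |ε| < ε₀ →
      ∃ u : ℝ × ℝ → ℝ,
        -- twice continuously differentiable (up to the boundary of the strip)
        ContDiff ℝ 2 u ∧
        -- bounded together with all partial derivatives up to order two on the closed strip
        (∃ K : ℝ, ∀ x : ℝ, ∀ y ∈ Icc (-(π / 2)) (π / 2),
          |u (x, y)| ≤ K ∧ |pdx u (x, y)| ≤ K ∧ |pdy u (x, y)| ≤ K ∧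
          |pdx (pdx u) (x, y)| ≤ K ∧ |pdy (pdx u) (x, y)| ≤ K ∧
          |pdx (pdy u) (x, y)| ≤ K ∧ |pdy (pdy u) (x, y)| ≤ K) ∧
        -- the quasilinear PDE ∇·((1 + 2w₁|∇u|²)∇u) + u − mε²u = 0 in Ω
        (∀ x : ℝ, ∀ y ∈ Ioo (-(π / 2)) (π / 2),
          pdx (fun p => (1 + 2 * w₁ * ((pdx u p) ^ 2 + (pdy u p) ^ 2)) * pdx u p) (x, y)
            + pdy (fun p => (1 + 2 * w₁ * ((pdx u p) ^ 2 + (pdy u p) ^ 2)) * pdy u p) (x, y)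
            + u (x, y) - m * ε ^ 2 * u (x, y) = 0) ∧
        -- homogeneous Dirichlet boundary conditions
        (∀ x : ℝ, u (x, -(π / 2)) = 0 ∧ u (x, π / 2) = 0) ∧
        -- (i) closeness to the explicit sech pulse profile
        (∀ x : ℝ, ∀ y ∈ Icc (-(π / 2)) (π / 2),
          |u (x, y) - a₁ * ε * (Real.cosh (κ₁ * ε * x))⁻¹ * Real.cos y| ≤ C * ε ^ 2) ∧
        -- (ii) decay to zero, uniformly in y, as |x| → ∞
        (∀ δ > (0 : ℝ), ∃ X : ℝ, ∀ x : ℝ, X ≤ |x| → ∀ y ∈ Icc (-(π / 2)) (π / 2),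
          |u (x, y)| ≤ δ) ∧
        -- in particular the solution is nontrivial: sup |u| ≥ a₁|ε| − Cε² > 0
        (0 < a₁ * |ε| - C * ε ^ 2 ∧
          ∃ x : ℝ, ∃ y ∈ Icc (-(π / 2)) (π / 2), a₁ * |ε| - C * ε ^ 2 ≤ |u (x, y)|) := by
  obtain ⟨η₀, hη₀, C, hC, hsol⟩ := exists_sol
  have hκ : 0 < κ₁ := by rw [hκ₁]; exact sqrt_pos.2 hm
  have hκ2 : κ₁ ^ 2 = m := by rw [hκ₁]; exact sq_sqrt hm.le
  have hfr : 0 < -4 * m / (3 * w₁) := div_pos_of_neg_of_neg (by linarith) (by linarith)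
  have ha : 0 < a₁ := by rw [ha₁]; exact sqrt_pos.2 hfr
  have ha2 : w₁ * a₁ ^ 2 = -4 * m / 3 := by
    have := hw₁.ne
    rw [ha₁, sq_sqrt hfr.le]; field_simp
  refine ⟨min (η₀ / κ₁) (1 / (C * κ₁)), by positivity, a₁ * C * κ₁, by positivity, ?_⟩
  intro ε hε hεl
  set η := κ₁ * |ε| with hη
  have hη0 : 0 < η := by positivity
  have hη1 : η < η₀ := by
    have := lt_of_lt_of_le hεl (min_le_left _ _)
    rw [lt_div_iff₀ hκ] at this
    linarith
  have hη2 : η ^ 2 = m * ε ^ 2 := by rw [hη, mul_pow, sq_abs, hκ2]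
  have hε2 : |ε| * |ε| = ε ^ 2 := by rw [← sq, sq_abs]
  obtain ⟨s⟩ := hsol η hη0 hη1
  have ex : pdx (fun p => a₁ * ε * s.v p) = fun p => a₁ * ε * s.vx p := by
    funext p
    exact ((s.dx p.1 p.2).const_mul (a₁ * ε)).deriv
  have ey : pdy (fun p => a₁ * ε * s.v p) = fun p => a₁ * ε * s.vy p := by
    funext p
    exact ((s.dy p.1 p.2).const_mul (a₁ * ε)).deriv
  have exx : pdx (fun p => a₁ * ε * s.vx p) = fun p => a₁ * ε * s.vxx p := by
    funext p
    exact ((s.dxx p.1 p.2).const_mul (a₁ * ε)).deriv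
  have exy : pdy (fun p => a₁ * ε * s.vx p) = fun p => a₁ * ε * s.vxy p := by
    funext p
    exact ((s.dxy p.1 p.2).const_mul (a₁ * ε)).deriv
  have eyx : pdx (fun p => a₁ * ε * s.vy p) = fun p => a₁ * ε * s.vxy p := by
    funext p
    exact ((s.dyx p.1 p.2).const_mul (a₁ * ε)).deriv
  have eyy : pdy (fun p => a₁ * ε * s.vy p) = fun p => a₁ * ε * s.vyy p := by
    funext p
    exact ((s.dyy p.1 p.2).const_mul (a₁ * ε)).deriv
  have bd : ∀ t : ℝ, |t| ≤ s.K → |a₁ * ε * t| ≤ a₁ * |ε| * s.K := by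
    intro t ht
    rw [abs_mul, abs_mul, abs_of_pos ha]
    gcongr
  have hclose : ∀ x y, |a₁ * ε * s.v (x, y) - a₁ * ε * (Real.cosh (κ₁ * ε * x))⁻¹ * Real.cos y|
      ≤ a₁ * C * κ₁ * ε ^ 2 := by
    intro x y
    have h1 : cosh (κ₁ * ε * x) = cosh (η * x) := by
      rw [← cosh_abs (κ₁ * ε * x), ← cosh_abs (η * x), hη]
      simp [abs_mul]
    rw [h1, show a₁ * ε * s.v (x, y) - a₁ * ε * (Real.cosh (η * x))⁻¹ * Real.cos y =
      a₁ * ε * (s.v (x, y) - (Real.cosh (η * x))⁻¹ * Real.cos y) by ring, abs_mul, abs_mul,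
      abs_of_pos ha]
    have := mul_le_mul_of_nonneg_left (s.close x y) (show 0 ≤ a₁ * |ε| by positivity)
    refine this.trans_eq ?_
    rw [hη, ← hε2]; ring
  refine ⟨fun p => a₁ * ε * s.v p, ?_, ?_, ?_, ?_, ?_, ?_, ?_, ?_⟩
  · have := cd2_of_partials s.dx s.dy (cd1_of_partials s.dxx s.dxy s.cxx s.cxy)
      (cd1_of_partials s.dyx s.dyy s.cxy s.cyy)
    exact contDiff_const.mul this
  · refine ⟨a₁ * |ε| * s.K, fun x y _ => ?_⟩
    rw [ex, ey, exx, exy, eyx, eyy]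
    exact ⟨bd _ (s.b _), bd _ (s.bx _), bd _ (s.by' _), bd _ (s.bxx _), bd _ (s.bxy _),
      bd _ (s.bxy _), bd _ (s.byy _)⟩
  · intro x y _
    rw [ex, ey]
    have h1 : pdx (fun p => (1 + 2 * w₁ * ((a₁ * ε * s.vx p) ^ 2 + (a₁ * ε * s.vy p) ^ 2)) *
        (a₁ * ε * s.vx p)) (x, y) = _ :=
      (((((((s.dxx x y).const_mul (a₁ * ε)).pow 2).add
        (((s.dyx x y).const_mul (a₁ * ε)).pow 2)).const_mul (2 * w₁)).const_add 1).mul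
        ((s.dxx x y).const_mul (a₁ * ε))).deriv
    have h2 : pdy (fun p => (1 + 2 * w₁ * ((a₁ * ε * s.vx p) ^ 2 + (a₁ * ε * s.vy p) ^ 2)) *
        (a₁ * ε * s.vy p)) (x, y) = _ :=
      (((((((s.dxy x y).const_mul (a₁ * ε)).pow 2).add
        (((s.dyy x y).const_mul (a₁ * ε)).pow 2)).const_mul (2 * w₁)).const_add 1).mul
        ((s.dyy x y).const_mul (a₁ * ε))).deriv
    rw [h1, h2]
    have hp := s.pde (x, y)
    rw [hη2] at hp
    simp only [Pi.add_apply, Pi.pow_apply]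
    push_cast
    set N := (3 * s.vx (x, y) ^ 2 * s.vxx (x, y) +
      s.vy (x, y) ^ 2 * s.vxx (x, y) + 4 * s.vx (x, y) * s.vy (x, y) * s.vxy (x, y) +
      s.vx (x, y) ^ 2 * s.vyy (x, y) + 3 * s.vy (x, y) ^ 2 * s.vyy (x, y)) with hN
    linear_combination a₁ * ε * hp + 2 * a₁ * ε ^ 3 * N * ha2
  · intro x
    simp [s.bdl, s.bdr]
  · intro x y _
    exact hclose x y
  · intro δ hδ
    obtain ⟨X, hX⟩ := s.decay (δ / (a₁ * |ε|)) (by positivity)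
    refine ⟨X, fun x hx y _ => ?_⟩
    have := hX x hx y
    rw [le_div_iff₀ (by positivity)] at this
    rw [abs_mul, abs_mul, abs_of_pos ha]
    linarith
  · have := lt_of_lt_of_le hεl (min_le_right _ _)
    rw [lt_div_iff₀ (by positivity)] at this
    have h3 : a₁ * |ε| * (|ε| * (C * κ₁)) < a₁ * |ε| * 1 :=
      mul_lt_mul_of_pos_left this (by positivity)
    have h4 : a₁ * |ε| * (|ε| * (C * κ₁)) = a₁ * C * κ₁ * ε ^ 2 := by rw [← hε2]; ring
    linarith
  · refine ⟨0, 0, ⟨by have := pi_pos; linarith, by have := pi_pos; linarith⟩, ?_⟩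
    have := hclose 0 0
    simp only [mul_zero, cosh_zero, inv_one, mul_one, cos_zero] at this
    have h5 := abs_sub_abs_le_abs_sub (a₁ * ε) (a₁ * ε * s.v (0, 0))
    rw [abs_sub_comm] at h5
    rw [abs_mul, abs_of_pos ha] at h5
    show a₁ * |ε| - a₁ * C * κ₁ * ε ^ 2 ≤ |a₁ * ε * s.v (0, 0)|
    linarith
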